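/- Let (W,S) be the affine Coxeter system of type Ẽ_7: S = {0,1,...,7} with m(1,3) = m(3,4) = m(4,5) = m(5,6) = m(6,7) = m(2,4) = m(0,1) = 3 and all other pairs commuting (m = 2). Then the homology of the weighted complex C_*(W) is: H_0 ≅ R/(Φ_2); H_1 = H_2 = 0; H_3 ≅ R/(Φ_3); H_4 = H_5 = 0; H_6 ≅ (R/(Φ_2))³ ⊕ R/(Φ_3) ⊕ R/(Φ_4) ⊕ R/(Φ_6) ⊕ R/(Φ_8) ⊕ R/(Φ_10) ⊕ R/(Φ_14) ⊕ R/(Φ_18); H_7 ≅ R; and H_k = 0 for all k ≥ 8. -/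

import Mathlib

open Polynomial CoxeterSystem

set_option synthInstance.maxHeartbeats 1000000
set_option maxHeartbeats 1000000

noncomputable section

/-- The ring `R = ℚ[q,q⁻¹]` of Laurent polynomials over `ℚ`. -/
abbrev R : Type := LaurentPolynomial ℚ

/-- The image of the `d`-th cyclotomic polynomial `Φ_d` in `R`. -/
def cyc (d : ℕ) : R := Polynomial.toLaurent (Polynomial.cyclotomic d ℚ)

/-- The `R`-module `R/(Φ_d)`. -/
abbrev CycQuot (d : ℕ) := R ⧸ Ideal.span {cyc d}

variable {B : Type*} [Fintype B] [LinearOrder B] {W : Type*} [Group W]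
  {M : CoxeterMatrix B} (cs : CoxeterSystem M W)

/-- The standard parabolic subgroup `W_σ` generated by `σ ⊆ S`. -/
def parabolic (σ : Finset B) : Subgroup W := Subgroup.closure (cs.simple '' σ)

/-- The Poincaré polynomial `W_σ(q) = Σ_{w ∈ W_σ} q^{ℓ(w)}` of the standard parabolic
subgroup `W_σ` (defined to be `0` if `W_σ` is infinite). -/
def poin (σ : Finset B) : ℚ[X] :=
  letI := Classical.dec ((parabolic cs σ : Set W).Finite)
  if h : (parabolic cs σ : Set W).Finite then ∑ w ∈ h.toFinset, X ^ cs.length w else 0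

/-- The set of simplices `σ ∈ K_W` with `|σ| = k`, i.e. the subsets of `S` of
cardinality `k` generating a finite standard parabolic subgroup. -/
abbrev KW (k : ℕ) := {σ : Finset B // σ.card = k ∧ (parabolic cs σ : Set W).Finite}

noncomputable instance (k : ℕ) : Fintype (KW cs k) := Fintype.ofFinite _

/-- The coefficient of `e_τ` in `∂ e_σ`: it is
`(−1)^{#{t ∈ σ : t < s}} · W_σ(q)/W_{σ∖{s}}(q)` if `τ = σ ∖ {s}` for some `s ∈ σ`,
and `0` otherwise. -/
def bcoeff (σ τ : Finset B) : R :=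
  ∑ s ∈ σ, if τ = σ.erase s then
      (-1 : R) ^ (σ.filter (fun t => t < s)).card *
        Polynomial.toLaurent (poin cs σ / poin cs τ)
    else 0

/-- The boundary map `∂ : C_{k+1} → C_k` of the weighted complex `C_*(W)`, where
`C_k = ⊕_{σ ∈ K_W, |σ| = k} R·e_σ`. -/
def bdry (k : ℕ) : (KW cs (k + 1) → R) →ₗ[R] (KW cs k → R) :=
  Matrix.mulVecLin (Matrix.of fun (τ : KW cs k) (σ : KW cs (k + 1)) => bcoeff cs σ.1 τ.1)

/-- The submodule of cycles in degree `k` of the weighted complex. -/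
def cycles : (k : ℕ) → Submodule R (KW cs k → R)
  | 0 => ⊤
  | (k + 1) => LinearMap.ker (bdry cs k)

/-- The `k`-th homology `H_k(C_*(W))` of the weighted complex: cycles modulo boundaries. -/
abbrev Hgy (k : ℕ) :=
  cycles cs k ⧸ Submodule.comap (cycles cs k).subtype (LinearMap.range (bdry cs k))

end

set_option linter.unusedSectionVars false

section SimplyLaced

variable {B W : Type*} [DecidableEq B] [Group W] {M : CoxeterMatrix B}

/-- The action of the `i`-th simple reflection of a simply-laced Coxeter group on the coordinates
(with respect to the simple roots) of a vector of the dual geometric representation. -/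
def dualRefl (adj : B → B → Bool) (i : B) : (B → ℤ) →ₗ[ℤ] (B → ℤ) where
  toFun v t := if t = i then -v i else if adj i t then v t + v i else v t
  map_add' u v := by
    funext t
    simp only [Pi.add_apply]
    split_ifs <;> ring
  map_smul' c v := by
    funext t
    simp only [Pi.smul_apply, smul_eq_mul, RingHom.id_apply]
    split_ifs <;> ring

lemma dualRefl_apply (adj : B → B → Bool) (i : B) (v : B → ℤ) (t : B) :
    dualRefl adj i v t = if t = i then -v i else if adj i t then v t + v i else v t := rfl

/-- The Coxeter matrix `M` is simply laced with Dynkin diagram `adj`. -/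
def IsSimplyLaced (M : CoxeterMatrix B) (adj : B → B → Bool) : Prop :=
  ∀ i j, i ≠ j → M i j = if adj i j then 3 else 2

variable {adj : B → B → Bool}

lemma IsSimplyLaced.symm (h : IsSimplyLaced M adj) {i j : B} (hij : i ≠ j) :
    adj i j = adj j i := by
  have h1 := h i j hij
  have h2 := h j i hij.symm
  rw [M.symmetric, h2] at h1
  cases hi : adj i j <;> cases hj : adj j i <;> simp_all

lemma dualRefl_liftable (h : IsSimplyLaced M adj) : M.IsLiftable (dualRefl adj) := by
  intro i j
  by_cases hij : i = j
  · subst hij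
    rw [M.diagonal, pow_one]
    ext1 v
    funext t
    simp only [Module.End.mul_apply, dualRefl_apply, Module.End.one_apply]
    split_ifs <;> simp_all
  · have hs := h.symm hij
    have hji : ¬ j = i := fun e => hij e.symm
    rw [h i j hij]
    cases ha : adj i j
    · rw [ha] at hs
      ext1 v
      funext t
      simp only [Bool.false_eq_true, if_false, pow_succ, pow_zero, one_mul, Module.End.mul_apply,
        dualRefl_apply, Module.End.one_apply, ha, ← hs, if_neg hij, if_neg hji, if_true]
      split_ifs <;> (try subst_vars) <;> (try ring1); simp_all
    · rw [ha] at hs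
      ext1 v
      funext t
      simp only [if_true, pow_succ, pow_zero, one_mul, Module.End.mul_apply, if_neg hij, if_neg hji,
        dualRefl_apply, Module.End.one_apply, ha, ← hs]
      split_ifs <;> (try subst_vars) <;> (try ring1); simp_all

/-- The dual geometric representation of a simply-laced Coxeter group. -/
noncomputable def dualRep (cs : CoxeterSystem M W) (h : IsSimplyLaced M adj) :
    W →* Module.End ℤ (B → ℤ) :=
  cs.lift ⟨dualRefl adj, dualRefl_liftable h⟩

variable (cs : CoxeterSystem M W) (h : IsSimplyLaced M adj)

lemma dualRep_simple (i : B) : dualRep cs h (cs.simple i) = dualRefl adj i :=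
  cs.lift_apply_simple _ i

lemma dualRep_simple_mul (i : B) (w : W) (v : B → ℤ) :
    dualRep cs h (cs.simple i * w) v = dualRefl adj i (dualRep cs h w v) := by
  rw [map_mul, dualRep_simple, Module.End.mul_apply]

lemma simple_comm (h : IsSimplyLaced M adj) {i j : B} (hij : i ≠ j) (ha : adj i j = false) :
    cs.simple i * cs.simple j = cs.simple j * cs.simple i := by
  have := cs.simple_mul_simple_pow i j
  rw [h i j hij, ha] at this
  simp only [Bool.false_eq_true, if_false, pow_two] at this
  have h2 := eq_inv_of_mul_eq_one_left this
  simpa using h2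

lemma simple_braid (h : IsSimplyLaced M adj) {i j : B} (hij : i ≠ j) (ha : adj i j = true) :
    cs.simple i * cs.simple j * cs.simple i = cs.simple j * cs.simple i * cs.simple j := by
  have := cs.simple_mul_simple_pow i j
  rw [h i j hij, ha] at this
  have e : cs.simple i * cs.simple j * cs.simple i * (cs.simple j * cs.simple i * cs.simple j)
      = 1 := by
    simpa [pow_succ, mul_assoc] using this
  have h2 := eq_inv_of_mul_eq_one_left e
  simpa [mul_assoc] using h2

/-- If `s` is not a left descent of `w`, then `w` maps the dominant chamber to the positive side of
the wall of `s`. -/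
theorem dualRep_nonneg {v : B → ℤ} (hv : ∀ t, 0 ≤ v t) (n : ℕ) :
    ∀ (w : W) (s : B), cs.length w = n → cs.length w < cs.length (cs.simple s * w) →
      0 ≤ dualRep cs h w v s := by
  induction n using Nat.strong_induction_on with
  | _ n ih =>
  intro w s hn hs
  by_cases hw : w = 1
  · subst hw
    simpa using hv s
  obtain ⟨t, ht⟩ := cs.exists_leftDescent_of_ne_one hw
  unfold CoxeterSystem.IsLeftDescent at ht
  have hts : t ≠ s := by
    rintro rfl
    omega
  obtain ⟨u, hu⟩ : ∃ u, u = cs.simple t * w := ⟨_, rfl⟩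
  have hwu : w = cs.simple t * u := by simp [hu]
  have hlu : cs.length w = cs.length u + 1 := by
    rcases cs.length_simple_mul w t with e | e
    · omega
    · rw [hu, e]
  have hut : 0 ≤ dualRep cs h u v t := by
    refine ih _ (by omega) u t rfl ?_
    rw [← hwu]
    omega
  rw [hwu, dualRep_simple_mul, dualRefl_apply, if_neg hts.symm]
  cases ha : adj t s
  · refine ih _ (by omega) u s rfl ?_
    by_contra hcon
    have hlt : cs.length (cs.simple s * u) + 1 = cs.length u := by
      rcases cs.length_simple_mul u s with e | e <;> omega
    have e1 : cs.simple s * w = cs.simple t * (cs.simple s * u) := by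
      rw [hwu, ← mul_assoc, ← mul_assoc, simple_comm cs h hts ha]
    have := cs.length_mul_le (cs.simple t) (cs.simple s * u)
    rw [cs.length_simple, ← e1] at this
    omega
  · simp only [if_true]
    by_cases hus : cs.length u < cs.length (cs.simple s * u)
    · have := ih _ (by omega) u s rfl hus
      omega
    · have hlt : cs.length (cs.simple s * u) + 1 = cs.length u := by
        rcases cs.length_simple_mul u s with e | e <;> omega
      obtain ⟨x, hx⟩ : ∃ x, x = cs.simple s * u := ⟨_, rfl⟩
      have hux : u = cs.simple s * x := by simp [hx]
      rw [← hx] at hlt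
      have hst : adj s t = true := by rw [← h.symm hts, ha]
      rw [hux, dualRep_simple_mul, dualRefl_apply, dualRefl_apply, if_pos rfl, if_neg hts, hst]
      simp only [if_true]
      have : 0 ≤ dualRep cs h x v t := by
        refine ih _ (by omega) x t rfl ?_
        by_contra hcon
        have hlt2 : cs.length (cs.simple t * x) + 1 = cs.length x := by
          rcases cs.length_simple_mul x t with e | e <;> omega
        have e1 : cs.simple s * w = cs.simple t * (cs.simple s * (cs.simple t * x)) := by
          rw [hwu, hux]
          have := simple_braid cs h hts ha
          simp only [← mul_assoc] at this ⊢
          rw [this]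
        have l1 := cs.length_mul_le (cs.simple t) (cs.simple s * (cs.simple t * x))
        have l2 := cs.length_mul_le (cs.simple s) (cs.simple t * x)
        rw [cs.length_simple] at l1 l2
        rw [← e1] at l1
        omega
      omega

lemma length_simple_mul_of_pos {v : B → ℤ} (hv : ∀ t, 0 ≤ v t) {w : W} {s : B}
    (hs : 0 < dualRep cs h w v s) : cs.length (cs.simple s * w) = cs.length w + 1 := by
  rcases cs.length_simple_mul w s with e | e
  · exact e
  · have := dualRep_nonneg cs h hv _ (cs.simple s * w) s rfl (by simp; omega)
    rw [dualRep_simple_mul, dualRefl_apply, if_pos rfl] at this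
    omega

lemma dualRep_nonpos_of_descent {v : B → ℤ} (hv : ∀ t, 0 ≤ v t) {w : W} {s : B}
    (hs : cs.length (cs.simple s * w) < cs.length w) : dualRep cs h w v s ≤ 0 := by
  by_contra hcon
  have := length_simple_mul_of_pos cs h hv (w := w) (s := s) (by omega)
  omega

/-- The stabilizer of a dominant vector is generated by the simple reflections fixing it. -/
lemma mem_closure_of_dualRep_eq {v : B → ℤ} (hv : ∀ t, 0 ≤ v t) (n : ℕ) :
    ∀ w : W, cs.length w = n → dualRep cs h w v = v →
      w ∈ Subgroup.closure (cs.simple '' {t | v t = 0}) := by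
  induction n using Nat.strong_induction_on with
  | _ n ih =>
  intro w hn hw
  by_cases hw1 : w = 1
  · subst hw1
    exact one_mem _
  obtain ⟨t, ht⟩ := cs.exists_leftDescent_of_ne_one hw1
  have h0 : v t = 0 := by
    have := dualRep_nonpos_of_descent cs h hv ht
    rw [hw] at this
    exact le_antisymm this (hv t)
  have hfix : dualRefl adj t v = v := by
    funext u
    rw [dualRefl_apply]
    split_ifs with h1 h2
    · rw [h1, h0, neg_zero]
    · rw [h0, add_zero]
    · rfl
  have h1 : cs.simple t ∈ Subgroup.closure (cs.simple '' {t | v t = 0}) :=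
    Subgroup.subset_closure ⟨t, h0, rfl⟩
  have h2 := ih _ (hn ▸ ht) (cs.simple t * w) rfl (by rw [dualRep_simple_mul, hw, hfix])
  simpa using mul_mem h1 h2

lemma dualRep_eq_of_mem_closure {v : B → ℤ} {w : W}
    (hw : w ∈ Subgroup.closure (cs.simple '' {t | v t = 0})) : dualRep cs h w v = v := by
  induction hw using Subgroup.closure_induction_left with
  | one => simp
  | mul_left x hx y _ ih =>
    obtain ⟨t, ht, rfl⟩ := hx
    rw [dualRep_simple_mul, ih]
    funext u
    rw [dualRefl_apply]
    have ht : v t = 0 := ht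
    split_ifs with h1 h2
    · rw [h1, ht, neg_zero]
    · rw [ht, add_zero]
    · rfl
  | inv_mul_cancel x hx y _ ih =>
    obtain ⟨t, ht, rfl⟩ := hx
    rw [cs.inv_simple, dualRep_simple_mul, ih]
    funext u
    rw [dualRefl_apply]
    have ht : v t = 0 := ht
    split_ifs with h1 h2
    · rw [h1, ht, neg_zero]
    · rw [ht, add_zero]
    · rfl

/-- Left multiplication by a simple reflection identifies the elements carrying a dominant vector
`v₀` to `v` with those carrying it to `s v`; if `v s < 0` it lowers the length by one. -/
lemma exists_fiber [Fintype B] [LinearOrder B] {I J : Finset B} (hJI : J ⊆ I) {v₀ : B → ℤ}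
    (hv₀ : ∀ t, 0 ≤ v₀ t) (hJ : ∀ t, v₀ t = 0 ↔ t ∈ J) (hfin : (parabolic cs J : Set W).Finite)
    (O : Finset (B → ℤ)) (lev : (B → ℤ) → ℕ) (hlev : lev v₀ = 0)
    (hdesc : ∀ v ∈ O, v ≠ v₀ → ∃ i ∈ I, v i < 0 ∧ dualRefl adj i v ∈ O ∧
      lev (dualRefl adj i v) + 1 = lev v) (n : ℕ) :
    ∀ v ∈ O, lev v = n → ∃ F : Finset W,
      (∀ w, w ∈ F ↔ w ∈ parabolic cs I ∧ dualRep cs h w v₀ = v) ∧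
      ∑ w ∈ F, (X : ℚ[X]) ^ cs.length w = X ^ n * poin cs J := by
  have hstab : {t | v₀ t = 0} = (J : Set B) := by
    ext t
    simp [hJ]
  have hbase : ∃ F : Finset W, (∀ w, w ∈ F ↔ w ∈ parabolic cs I ∧ dualRep cs h w v₀ = v₀) ∧
      ∑ w ∈ F, (X : ℚ[X]) ^ cs.length w = X ^ 0 * poin cs J := by
    refine ⟨hfin.toFinset, fun w => ?_, ?_⟩
    · rw [Set.Finite.mem_toFinset]
      constructor
      · intro hw
        refine ⟨Subgroup.closure_mono (Set.image_mono (by exact_mod_cast hJI)) hw, ?_⟩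
        apply dualRep_eq_of_mem_closure
        rw [hstab]
        exact hw
      · rintro ⟨-, hw⟩
        have := mem_closure_of_dualRep_eq cs h hv₀ _ w rfl hw
        rw [hstab] at this
        exact this
    · rw [poin, dif_pos hfin, pow_zero, one_mul]
  induction n with
  | zero =>
    intro v hv hl
    by_cases hvv : v = v₀
    · rw [hvv]
      exact hbase
    · obtain ⟨i, -, -, -, h4⟩ := hdesc v hv hvv
      omega
  | succ n ih =>
    intro v hv hl
    have hvv : v ≠ v₀ := by
      rintro rfl
      omega
    obtain ⟨i, hi, hneg, hmem, hl'⟩ := hdesc v hv hvv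
    obtain ⟨F, hF, hsum⟩ := ih _ hmem (by omega)
    have hinv : dualRefl adj i (dualRefl adj i v) = v := by
      have := dualRep_simple_mul cs h i (cs.simple i) v
      rw [dualRep_simple, cs.simple_mul_simple_self, map_one] at this
      exact this.symm
    have hsi : cs.simple i ∈ parabolic cs I := Subgroup.subset_closure ⟨i, by exact_mod_cast hi, rfl⟩
    have hinj : Function.Injective (fun w : W => cs.simple i * w) := mul_right_injective _
    refine ⟨F.map ⟨_, hinj⟩, fun w => ?_, ?_⟩
    · rw [Finset.mem_map]
      constructor
      · rintro ⟨u, hu, rfl⟩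
        rw [hF] at hu
        refine ⟨mul_mem hsi hu.1, ?_⟩
        simp only [Function.Embedding.coeFn_mk]
        rw [dualRep_simple_mul, hu.2, hinv]
      · rintro ⟨hw, hwv⟩
        refine ⟨cs.simple i * w, (hF _).2 ⟨mul_mem hsi hw, ?_⟩, by simp⟩
        rw [dualRep_simple_mul, hwv]
    · rw [Finset.sum_map, pow_succ', mul_assoc, ← hsum, Finset.mul_sum]
      refine Finset.sum_congr rfl fun w hw => ?_
      have hpos : 0 < dualRep cs h w v₀ i := by
        rw [((hF w).1 hw).2, dualRefl_apply, if_pos rfl]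
        omega
      simp only [Function.Embedding.coeFn_mk]
      rw [length_simple_mul_of_pos cs h hv₀ hpos, pow_succ']

/-- The Poincaré polynomial of `W_I` is that of `W_J` times the generating function of the orbit
of a dominant vector with stabilizer `W_J`. -/
theorem poin_eq_orbit_sum (h : IsSimplyLaced M adj) [Fintype B] [LinearOrder B]
    {I J : Finset B} (hJI : J ⊆ I) {v₀ : B → ℤ}
    (hv₀ : ∀ t, 0 ≤ v₀ t) (hJ : ∀ t, v₀ t = 0 ↔ t ∈ J) (hfin : (parabolic cs J : Set W).Finite)
    (O : Finset (B → ℤ)) (lev : (B → ℤ) → ℕ) (hO : v₀ ∈ O) (hlev : lev v₀ = 0)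
    (hclosed : ∀ v ∈ O, ∀ i ∈ I, dualRefl adj i v ∈ O)
    (hdesc : ∀ v ∈ O, v ≠ v₀ → ∃ i ∈ I, v i < 0 ∧ lev (dualRefl adj i v) + 1 = lev v) :
    (parabolic cs I : Set W).Finite ∧ poin cs I = (∑ v ∈ O, X ^ lev v) * poin cs J := by
  classical
  have hdesc' : ∀ v ∈ O, v ≠ v₀ → ∃ i ∈ I, v i < 0 ∧ dualRefl adj i v ∈ O ∧
      lev (dualRefl adj i v) + 1 = lev v := by
    intro v hv hvv
    obtain ⟨i, hi, h1, h2⟩ := hdesc v hv hvv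
    exact ⟨i, hi, h1, hclosed v hv i hi, h2⟩
  have hfib := fun v hv => exists_fiber cs h hJI hv₀ hJ hfin O lev hlev hdesc' (lev v) v hv rfl
  choose F hF hsum using hfib
  have horb : ∀ w ∈ parabolic cs I, dualRep cs h w v₀ ∈ O := by
    intro w hw
    induction hw using Subgroup.closure_induction_left with
    | one => simpa using hO
    | mul_left x hx y _ ih =>
      obtain ⟨t, ht, rfl⟩ := hx
      rw [dualRep_simple_mul]
      exact hclosed _ ih t (by exact_mod_cast ht)
    | inv_mul_cancel x hx y _ ih =>
      obtain ⟨t, ht, rfl⟩ := hx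
      rw [cs.inv_simple, dualRep_simple_mul]
      exact hclosed _ ih t (by exact_mod_cast ht)
  have hmem : ∀ w, w ∈ parabolic cs I ↔ w ∈ O.attach.biUnion (fun v => F v.1 v.2) := by
    intro w
    simp only [Finset.mem_biUnion, Finset.mem_attach, true_and, Subtype.exists]
    constructor
    · intro hw
      exact ⟨_, horb w hw, (hF _ _ w).2 ⟨hw, rfl⟩⟩
    · rintro ⟨v, hv, hw⟩
      exact ((hF _ _ w).1 hw).1
  have hfinI : (parabolic cs I : Set W).Finite :=
    (O.attach.biUnion (fun v => F v.1 v.2)).finite_toSet.subset fun w hw => (hmem w).1 hw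
  refine ⟨hfinI, ?_⟩
  rw [poin, dif_pos hfinI]
  have hset : hfinI.toFinset = O.attach.biUnion (fun v => F v.1 v.2) := by
    ext w
    rw [Set.Finite.mem_toFinset]
    exact hmem w
  rw [hset, Finset.sum_biUnion]
  · rw [Finset.sum_mul, ← Finset.sum_attach O]
    exact Finset.sum_congr rfl fun v _ => hsum v.1 v.2
  · intro a _ b _ hab
    rw [Function.onFun, Finset.disjoint_left]
    intro w ha hb
    exact hab (Subtype.ext (((hF _ _ w).1 ha).2.symm.trans ((hF _ _ w).1 hb).2))

/-- A simply-laced Coxeter group with a positive null root is infinite. -/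
theorem not_finite_parabolic_univ (h : IsSimplyLaced M adj) [Fintype B] [LinearOrder B] (δ : B → ℤ)
    (hδ : ∀ i (v : B → ℤ), ∑ t, δ t * dualRefl adj i v t = ∑ t, δ t * v t)
    (hpos : 0 < ∑ t, δ t) : ¬ (parabolic cs Finset.univ : Set W).Finite := by
  intro hfin
  have htop : parabolic cs Finset.univ = ⊤ := by
    rw [parabolic, Finset.coe_univ, Set.image_univ, cs.subgroup_closure_range_simple]
  rw [htop] at hfin
  have : Finite W := Set.finite_univ_iff.1 (by simpa using hfin)
  have := Fintype.ofFinite W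
  have hpair : ∀ w : W, ∑ t, δ t * dualRep cs h w 1 t = ∑ t, δ t := by
    intro w
    induction w using cs.simple_induction_left with
    | one => simp
    | mul_simple_left w i ih => rw [dualRep_simple_mul, hδ, ih]
  have hzero : ∑ w : W, dualRep cs h w 1 = 0 := by
    funext i
    have hinv : dualRefl adj i (∑ w : W, dualRep cs h w 1) = ∑ w : W, dualRep cs h w 1 := by
      rw [map_sum]
      simp only [← dualRep_simple_mul]
      exact Fintype.sum_equiv (Equiv.mulLeft (cs.simple i)) _ _ fun w => rfl
    have := congrFun hinv i
    rw [dualRefl_apply, if_pos rfl] at this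
    simp only [Pi.zero_apply]
    omega
  have h1 : ∑ t, δ t * (∑ w : W, dualRep cs h w 1) t = Fintype.card W * ∑ t, δ t := by
    simp only [Finset.sum_apply, Finset.mul_sum]
    rw [Finset.sum_comm]
    simp only [hpair, Finset.sum_const, Finset.card_univ, nsmul_eq_mul, ← Finset.mul_sum]
  rw [hzero] at h1
  have h2 : (0 : ℤ) < Fintype.card W := by exact_mod_cast Fintype.card_pos
  simp only [Pi.zero_apply, mul_zero, Finset.sum_const_zero] at h1
  nlinarith

end SimplyLaced

section SimplicialChains

variable {B A : Type*} [Fintype B] [LinearOrder B] [CommRing A]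

/-- The boundary map of the augmented chain complex of the full simplex on the vertex set `B`. -/
def bd : (Finset B → A) →ₗ[A] (Finset B → A) where
  toFun c σ := ∑ s, if s ∈ σ then 0 else (-1) ^ (σ.filter (· < s)).card * c (insert s σ)
  map_add' c c' := by
    funext σ
    simp only [Pi.add_apply, ← Finset.sum_add_distrib]
    refine Finset.sum_congr rfl fun s _ => ?_
    split_ifs <;> ring
  map_smul' a c := by
    funext σ
    simp only [Pi.smul_apply, smul_eq_mul, RingHom.id_apply, Finset.mul_sum]
    refine Finset.sum_congr rfl fun s _ => ?_
    split_ifs <;> ring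

lemma bd_apply (c : Finset B → A) (σ : Finset B) :
    bd c σ = ∑ s, if s ∈ σ then 0 else (-1) ^ (σ.filter (· < s)).card * c (insert s σ) := rfl

lemma bd_eq_zero {c : Finset B → A} {σ : Finset B} (h : ∀ s, s ∉ σ → c (insert s σ) = 0) :
    bd c σ = 0 := by
  rw [bd_apply]
  refine Finset.sum_eq_zero fun s _ => ?_
  split_ifs with hs
  · rfl
  · rw [h s hs, mul_zero]

lemma insert_inj_of_notMem {σ : Finset B} {s t : B} (hs : s ∉ σ) (h : insert s σ = insert t σ) :
    s = t := by
  have : s ∈ insert t σ := h ▸ Finset.mem_insert_self s σ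
  exact (Finset.mem_insert.1 this).resolve_right hs

lemma bd_eq_of_unique {c : Finset B → A} {σ : Finset B} {s : B} (hs : s ∉ σ)
    (h : ∀ t, t ∉ σ → t ≠ s → c (insert t σ) = 0) :
    bd c σ = (-1) ^ (σ.filter (· < s)).card * c (insert s σ) := by
  rw [bd_apply, Finset.sum_eq_single s]
  · rw [if_neg hs]
  · intro t _ hts
    split_ifs with ht
    · rfl
    · rw [h t ht hts, mul_zero]
  · simp

lemma bd_single {σ : Finset B} {s : B} (hs : s ∉ σ) (a : A) :
    bd (Pi.single (insert s σ) a) σ = (-1) ^ (σ.filter (· < s)).card * a := by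
  rw [bd_eq_of_unique hs, Pi.single_eq_same]
  intro t ht hts
  exact Pi.single_eq_of_ne (fun e => hts (insert_inj_of_notMem ht e)) _

lemma bd_bd [NoZeroDivisors A] [CharZero A] (c : Finset B → A) : bd (bd c) = 0 := by
  funext ρ
  set g : B → B → A := fun s t => if s ∈ ρ then 0 else if t ∈ insert s ρ then 0 else
    (-1) ^ (ρ.filter (· < s)).card * ((-1) ^ ((insert s ρ).filter (· < t)).card *
      c (insert t (insert s ρ))) with hg
  have hbd : bd (bd c) ρ = ∑ s, ∑ t, g s t := by
    rw [bd_apply]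
    refine Finset.sum_congr rfl fun s _ => ?_
    simp only [hg]
    split_ifs with hs
    · simp
    · rw [bd_apply, Finset.mul_sum]
      refine Finset.sum_congr rfl fun t _ => ?_
      split_ifs <;> simp
  have hlt : ∀ s t, s < t → g s t = - g t s := by
    intro s t hst
    simp only [hg]
    by_cases hs : s ∈ ρ
    · simp [hs]
    by_cases ht : t ∈ ρ
    · simp [ht]
    have h1 : t ∉ insert s ρ := by simp [ht, hst.ne']
    have h2 : s ∉ insert t ρ := by simp [hs, hst.ne]
    rw [if_neg hs, if_neg h1, if_neg ht, if_neg h2, Finset.filter_insert, if_pos hst,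
      Finset.filter_insert, if_neg (not_lt.2 hst.le),
      Finset.card_insert_of_notMem (by simp [hs]), Finset.insert_comm]
    ring
  have hanti : ∀ s t, g s t = - g t s := by
    intro s t
    rcases lt_trichotomy s t with hst | hst | hst
    · exact hlt s t hst
    · subst hst
      simp [hg]
    · rw [hlt t s hst, neg_neg]
  rw [hbd, Pi.zero_apply]
  have : ∑ s, ∑ t, g s t = - ∑ s, ∑ t, g s t := by
    conv_lhs => rw [Finset.sum_comm]
    rw [← Finset.sum_neg_distrib]
    refine Finset.sum_congr rfl fun s _ => ?_
    rw [← Finset.sum_neg_distrib]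
    exact Finset.sum_congr rfl fun t _ => hanti t s
  exact CharZero.eq_neg_self_iff.1 this

/-- Gaussian elimination along an acyclic matching, whose pairs are `(σ, insert s σ)` for `(σ, s)`
in the list `L`: a chain can be changed by a boundary so as to vanish on the lower cells, without
losing divisibility by powers of `p`. -/
lemma exists_elimination (p : A) (w w' : Finset B → ℕ)
    (hmono : ∀ τ, ∀ t ∈ τ, w' (τ.erase t) ≤ w τ) (L : List (Finset B × B)) :
    (∀ x ∈ L, x.2 ∉ x.1 ∧ w (insert x.2 x.1) ≤ w' x.1) →
    L.Pairwise (fun x y => ¬ x.1 ⊆ insert y.2 y.1) →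
    ∀ c : Finset B → A, (∀ σ, p ^ w' σ ∣ c σ) →
      ∃ b : Finset B → A, (∀ τ, b τ ≠ 0 → ∃ x ∈ L, τ = insert x.2 x.1) ∧ (∀ τ, p ^ w τ ∣ b τ) ∧
        ∀ x ∈ L, (c - bd b) x.1 = 0 := by
  induction L with
  | nil => exact fun _ _ c _ => ⟨0, by simp, by simp, by simp⟩
  | cons x L ih =>
    intro hL hord c hc
    obtain ⟨hx, hwx⟩ := hL x List.mem_cons_self
    rw [List.pairwise_cons] at hord
    set a : A := (-1) ^ (x.1.filter (· < x.2)).card * c x.1 with ha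
    have hpa : p ^ w (insert x.2 x.1) ∣ a :=
      (pow_dvd_pow p hwx).trans ((hc x.1).mul_left _)
    have hzero : (c - bd (Pi.single (insert x.2 x.1) a)) x.1 = 0 := by
      rw [Pi.sub_apply, bd_single hx, ha, ← mul_assoc, ← pow_add, ← two_mul, pow_mul]
      simp
    have hdvd : ∀ τ, p ^ w τ ∣ (Pi.single (insert x.2 x.1) a : Finset B → A) τ := by
      intro τ
      by_cases hτ : τ = insert x.2 x.1
      · subst hτ
        rwa [Pi.single_eq_same]
      · rw [Pi.single_eq_of_ne hτ]
        exact dvd_zero _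
    obtain ⟨b, hb1, hb2, hb3⟩ := ih (fun y hy => hL y (List.mem_cons_of_mem _ hy)) hord.2
      (c - bd (Pi.single (insert x.2 x.1) a)) (by
        intro σ
        refine dvd_sub (hc σ) ?_
        rw [bd_apply]
        refine Finset.dvd_sum fun s _ => ?_
        split_ifs with hs
        · exact dvd_zero _
        · refine Dvd.dvd.mul_left ?_ _
          refine (pow_dvd_pow p ?_).trans (hdvd _)
          have := hmono (insert s σ) s (Finset.mem_insert_self _ _)
          rwa [Finset.erase_insert hs] at this)
    refine ⟨Pi.single (insert x.2 x.1) a + b, ?_, ?_, ?_⟩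
    · intro τ hτ
      by_cases hτx : τ = insert x.2 x.1
      · exact ⟨x, List.mem_cons_self, hτx⟩
      · rw [Pi.add_apply, Pi.single_eq_of_ne hτx, zero_add] at hτ
        obtain ⟨y, hy, hyτ⟩ := hb1 τ hτ
        exact ⟨y, List.mem_cons_of_mem _ hy, hyτ⟩
    · exact fun τ => dvd_add (hdvd τ) (hb2 τ)
    · intro y hy
      rw [map_add, ← sub_sub]
      rcases List.mem_cons.1 hy with rfl | hy
      · rw [Pi.sub_apply, hzero, zero_sub, neg_eq_zero]
        refine bd_eq_zero fun s hs => ?_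
        by_contra hne
        obtain ⟨z, hz, hzs⟩ := hb1 _ hne
        exact hord.1 z hz (hzs ▸ Finset.subset_insert _ _)
      · exact hb3 y hy

/-- A cycle supported on the upper cells of an acyclic matching vanishes. -/
lemma eq_zero_of_supported (L : List (Finset B × B)) :
    (∀ x ∈ L, x.2 ∉ x.1) → L.Pairwise (fun x y => ¬ x.1 ⊆ insert y.2 y.1) →
    ∀ c : Finset B → A, (∀ τ, c τ ≠ 0 → ∃ x ∈ L, τ = insert x.2 x.1) →
      (∀ x ∈ L, bd c x.1 = 0) → c = 0 := by
  induction L with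
  | nil =>
    intro _ _ c hc _
    funext τ
    by_contra hne
    obtain ⟨x, hx, -⟩ := hc τ hne
    simp at hx
  | cons x L ih =>
    intro hL hord c hc hcyc
    rw [List.pairwise_cons] at hord
    have hx := hL x List.mem_cons_self
    have h0 : c (insert x.2 x.1) = 0 := by
      have h1 := hcyc x List.mem_cons_self
      rw [bd_eq_of_unique hx] at h1
      · rcases neg_one_pow_eq_or A (x.1.filter (· < x.2)).card with e | e <;>
          simpa [e] using h1
      · intro t ht htx
        by_contra hne
        obtain ⟨y, hy, hyt⟩ := hc _ hne
        rcases List.mem_cons.1 hy with rfl | hy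
        · exact htx (insert_inj_of_notMem ht hyt)
        · exact hord.1 y hy (hyt ▸ Finset.subset_insert _ _)
    refine ih (fun y hy => hL y (List.mem_cons_of_mem _ hy)) hord.2 c ?_
      (fun y hy => hcyc y (List.mem_cons_of_mem _ hy))
    intro τ hτ
    obtain ⟨y, hy, hyτ⟩ := hc τ hτ
    rcases List.mem_cons.1 hy with rfl | hy
    · exact absurd (hyτ ▸ h0) hτ
    · exact ⟨y, hy, hyτ⟩

lemma bd_intCast (β : Finset B → ℤ) (σ : Finset B) :
    bd (fun τ => (β τ : A)) σ = (bd β σ : ℤ) := by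
  simp only [bd_apply, Int.cast_sum]
  refine Finset.sum_congr rfl fun s _ => ?_
  split_ifs <;> simp

end SimplicialChains

section WeightedComplex

variable {B : Type*} [Fintype B] [LinearOrder B] {W : Type*} [Group W]
  {M : CoxeterMatrix B} (cs : CoxeterSystem M W)

lemma cyc_ne_zero (d : ℕ) : cyc d ≠ 0 := by
  unfold cyc
  rw [Ne, ← map_zero Polynomial.toLaurent, Polynomial.toLaurent_injective.eq_iff]
  exact cyclotomic_ne_zero d ℚ

lemma isCoprime_cyc {d e : ℕ} (h : d ≠ e) : IsCoprime (cyc d) (cyc e) :=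
  (cyclotomic.isCoprime_rat h).map (Polynomial.toLaurent (R := ℚ))

instance : CharZero R :=
  charZero_of_injective_algebraMap (algebraMap ℚ R).injective

/-- The product of the powers `Φ_d ^ w d σ` over `d ∈ D`. -/
noncomputable def cycProd (D : Finset ℕ) (w : ℕ → Finset B → ℕ) (σ : Finset B) : R := ∏ d ∈ D, cyc d ^ w d σ

/-- The Poincaré polynomials of the finite proper parabolic subgroups factor as products of
cyclotomic polynomials `Φ_d`, `d ∈ D`, with exponents `w d σ < K`, and exactly the proper subsets
of `S` generate finite parabolic subgroups. -/
structure HasWeights (D : Finset ℕ) (w : ℕ → Finset B → ℕ) (K : ℕ) : Prop where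
  nonempty : D.Nonempty
  finite_iff : ∀ σ, (parabolic cs σ : Set W).Finite ↔ σ ≠ Finset.univ
  poin_eq : ∀ σ, σ ≠ Finset.univ → poin cs σ = ∏ d ∈ D, cyclotomic d ℚ ^ w d σ
  mono : ∀ d ∈ D, ∀ σ : Finset B, ∀ t ∈ σ, w d (σ.erase t) ≤ w d σ
  lt : ∀ d ∈ D, ∀ σ, w d σ < K

variable {cs} {D : Finset ℕ} {w : ℕ → Finset B → ℕ} {K : ℕ}

lemma cycProd_ne_zero (D : Finset ℕ) (w : ℕ → Finset B → ℕ) (σ : Finset B) :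
    cycProd D w σ ≠ 0 :=
  Finset.prod_ne_zero_iff.2 fun d _ => pow_ne_zero _ (cyc_ne_zero d)

lemma cycProd_eq_mul {d : ℕ} (hd : d ∈ D) (w : ℕ → Finset B → ℕ) (σ : Finset B) :
    cycProd D w σ = cyc d ^ w d σ * cycProd (D.erase d) w σ :=
  (Finset.mul_prod_erase D (fun d => cyc d ^ w d σ) hd).symm

lemma isCoprime_cyc_cycProd {d : ℕ} (hd : d ∉ D) (w : ℕ → Finset B → ℕ) (σ : Finset B) :
    IsCoprime (cyc d) (cycProd D w σ) :=
  IsCoprime.prod_right fun _ he =>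
    (isCoprime_cyc fun h : d = _ => hd (by rw [h]; exact he)).pow_right

lemma cycProd_dvd {w w' : ℕ → Finset B → ℕ} {σ τ : Finset B} (h : ∀ d ∈ D, w d σ ≤ w' d τ) :
    cycProd D w σ ∣ cycProd D w' τ :=
  Finset.prod_dvd_prod_of_dvd _ _ fun d hd => pow_dvd_pow _ (h d hd)

namespace HasWeights

lemma toLaurent_poin (H : HasWeights cs D w K) {σ : Finset B} (hσ : σ ≠ Finset.univ) :
    Polynomial.toLaurent (poin cs σ) = cycProd D w σ := by
  rw [H.poin_eq σ hσ, map_prod]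
  simp [cycProd, cyc]

lemma mul_toLaurent_div (H : HasWeights cs D w K) {σ : Finset B} {s : B}
    (hs : s ∉ σ) (hσ : insert s σ ≠ Finset.univ) :
    cycProd D w σ * Polynomial.toLaurent (poin cs (insert s σ) / poin cs σ) =
      cycProd D w (insert s σ) := by
  have hσ' : σ ≠ Finset.univ := fun h => hs (h ▸ Finset.mem_univ s)
  rw [← H.toLaurent_poin hσ, ← H.toLaurent_poin hσ', ← map_mul, EuclideanDomain.mul_div_cancel']
  · rw [H.poin_eq σ hσ']
    exact Finset.prod_ne_zero_iff.2 fun d _ => pow_ne_zero _ (cyclotomic_ne_zero d ℚ)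
  · rw [H.poin_eq σ hσ', H.poin_eq _ hσ]
    refine Finset.prod_dvd_prod_of_dvd _ _ fun d hd => pow_dvd_pow _ ?_
    have := H.mono d hd (insert s σ) s (Finset.mem_insert_self _ _)
    rwa [Finset.erase_insert hs] at this

lemma mono_insert (H : HasWeights cs D w K) {d : ℕ} (hd : d ∈ D) {σ : Finset B} {s : B}
    (hs : s ∉ σ) : w d σ ≤ w d (insert s σ) := by
  have := H.mono d hd (insert s σ) s (Finset.mem_insert_self _ _)
  rwa [Finset.erase_insert hs] at this

end HasWeights

variable (cs D w) in
/-- The embedding of the weighted complex into the chains of the simplex, multiplying the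
coefficient of `σ` by the Poincaré polynomial of `W_σ`. -/
noncomputable def ch (k : ℕ) : (KW cs k → R) →ₗ[R] (Finset B → R) where
  toFun z σ := letI := Classical.dec (σ.card = k ∧ (parabolic cs σ : Set W).Finite)
    if h : σ.card = k ∧ (parabolic cs σ : Set W).Finite then cycProd D w σ * z ⟨σ, h⟩ else 0
  map_add' z z' := by
    funext σ
    simp only [Pi.add_apply]
    split_ifs <;> ring
  map_smul' a z := by
    funext σ
    simp only [Pi.smul_apply, smul_eq_mul, RingHom.id_apply]
    split_ifs <;> ring

lemma ch_apply {k : ℕ} (z : KW cs k → R) (σ : KW cs k) :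
    ch cs D w k z σ.1 = cycProd D w σ.1 * z σ := by
  simp [ch, σ.2]

lemma ch_of_not {k : ℕ} (z : KW cs k → R) {σ : Finset B}
    (h : ¬ (σ.card = k ∧ (parabolic cs σ : Set W).Finite)) : ch cs D w k z σ = 0 := by
  simp [ch, h]

lemma ch_injective (k : ℕ) : Function.Injective (ch cs D w k) := by
  intro z z' h
  funext σ
  have := congrFun h σ.1
  rw [ch_apply, ch_apply] at this
  exact mul_left_cancel₀ (cycProd_ne_zero D w σ.1) this

lemma cycProd_dvd_ch {k : ℕ} (z : KW cs k → R) (σ : Finset B) :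
    cycProd D w σ ∣ ch cs D w k z σ := by
  by_cases h : σ.card = k ∧ (parabolic cs σ : Set W).Finite
  · exact ⟨_, ch_apply z ⟨σ, h⟩⟩
  · rw [ch_of_not z h]
    exact dvd_zero _

lemma exists_ch_eq {k : ℕ} {c : Finset B → R}
    (hc : ∀ σ, c σ ≠ 0 → σ.card = k ∧ (parabolic cs σ : Set W).Finite)
    (hdvd : ∀ σ, cycProd D w σ ∣ c σ) : ∃ z, ch cs D w k z = c := by
  choose q hq using hdvd
  refine ⟨fun σ => q σ.1, ?_⟩
  funext σ
  by_cases h : σ.card = k ∧ (parabolic cs σ : Set W).Finite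
  · rw [hq σ]
    exact ch_apply _ (⟨σ, h⟩ : KW cs k)
  · rw [ch_of_not _ h]
    by_contra hne
    exact h (hc σ fun h0 => hne h0.symm)

namespace HasWeights

lemma bd_ch (H : HasWeights cs D w K) {k : ℕ} (y : KW cs (k + 1) → R) :
    bd (ch cs D w (k + 1) y) = ch cs D w k (bdry cs k y) := by
  funext σ
  by_cases h : σ.card = k ∧ (parabolic cs σ : Set W).Finite
  swap
  · rw [ch_of_not _ h]
    refine bd_eq_zero fun s hs => ch_of_not _ fun h' => h ⟨?_, ?_⟩
    · have := h'.1
      rw [Finset.card_insert_of_notMem hs] at this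
      omega
    · rw [H.finite_iff]
      exact fun e => hs (e ▸ Finset.mem_univ s)
  rw [ch_apply (bdry cs k y) ⟨σ, h⟩, bd_apply]
  have hb : bdry cs k y ⟨σ, h⟩ = ∑ τ : KW cs (k + 1), bcoeff cs τ.1 σ * y τ := rfl
  rw [hb, Finset.mul_sum]
  have hterm : ∀ τ : KW cs (k + 1), cycProd D w σ * (bcoeff cs τ.1 σ * y τ) =
      ∑ s, if s ∉ σ ∧ insert s σ = τ.1 then
        (-1) ^ (σ.filter (· < s)).card * (cycProd D w τ.1 * y τ) else 0 := by
    intro τ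
    unfold bcoeff
    rw [Finset.sum_mul, Finset.mul_sum, ← Finset.sum_subset (Finset.subset_univ τ.1)]
    · refine Finset.sum_congr rfl fun s hs => ?_
      by_cases e : σ = τ.1.erase s
      · have hsσ : s ∉ σ := by simp [e]
        have hi : insert s σ = τ.1 := by rw [e, Finset.insert_erase hs]
        rw [if_pos e, if_pos ⟨hsσ, hi⟩, ← hi, Finset.filter_insert, if_neg (lt_irrefl s),
          ← H.mul_toLaurent_div hsσ (hi ▸ (H.finite_iff _).1 τ.2.2)]
        ring
      · rw [if_neg e, if_neg]
        · ring
        · rintro ⟨h1, h2⟩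
          exact e (by rw [← h2, Finset.erase_insert h1])
    · intro s _ hs
      rw [if_neg]
      rintro ⟨-, h2⟩
      exact hs (h2 ▸ Finset.mem_insert_self s σ)
  rw [Finset.sum_congr rfl fun τ _ => hterm τ, Finset.sum_comm]
  refine Finset.sum_congr rfl fun s _ => ?_
  by_cases hs : s ∈ σ
  · simp [hs]
  rw [if_neg hs]
  by_cases hf : (insert s σ).card = k + 1 ∧ (parabolic cs (insert s σ) : Set W).Finite
  · rw [Finset.sum_eq_single (⟨insert s σ, hf⟩ : KW cs (k + 1)), if_pos ⟨hs, rfl⟩,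
      ← ch_apply y ⟨insert s σ, hf⟩]
    · intro τ _ hτ
      exact if_neg fun e => hτ (Subtype.ext e.2.symm)
    · simp
  · rw [ch_of_not _ hf, mul_zero, Finset.sum_eq_zero]
    intro τ _
    exact if_neg fun e : s ∉ σ ∧ insert s σ = τ.1 => hf (e.2 ▸ τ.2)

lemma mem_cycles_iff (H : HasWeights cs D w K) {k : ℕ} {z : KW cs k → R} :
    z ∈ cycles cs k ↔ bd (ch cs D w k z) = 0 := by
  cases k with
  | zero =>
    refine ⟨fun _ => ?_, fun _ => trivial⟩
    funext σ
    refine bd_eq_zero fun s hs => ch_of_not _ fun h => ?_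
    exact absurd h.1 (by simp)
  | succ k =>
    rw [H.bd_ch, ← map_zero (ch cs D w k), (ch_injective k).eq_iff]
    exact LinearMap.mem_ker

end HasWeights

end WeightedComplex

section Torsion

variable {B : Type*} [Fintype B] [LinearOrder B] {W : Type*} [Group W]
  {M : CoxeterMatrix B} {cs : CoxeterSystem M W}
  {D : Finset ℕ} {w : ℕ → Finset B → ℕ} {K : ℕ} {k n : ℕ}

/-- The weight `w d` raised by one at the cells `σ i` with `d i = d`. -/
def raisedWeight (w : ℕ → Finset B → ℕ) {n : ℕ} (td : Fin n → ℕ) (tσ : Fin n → Finset B)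
    (d : ℕ) (σ : Finset B) : ℕ :=
  if ∃ i, td i = d ∧ tσ i = σ then w d σ + 1 else w d σ

/-- For every `d ∈ D`, acyclic matchings between the cells in degrees `k - 1`, `k` and `k + 1` which
preserve the weight `w d`, except that the cells `tσ i` with `td i = d` are matched to a cell of
weight one more. -/
structure IsMatching (D : Finset ℕ) (w : ℕ → Finset B → ℕ) (k : ℕ) {n : ℕ} (td : Fin n → ℕ)
    (tσ : Fin n → Finset B) (L L' : ℕ → List (Finset B × B)) : Prop where
  td_mem : ∀ i, td i ∈ D
  card_eq : ∀ i, (tσ i).card = k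
  lt_insert : ∀ i, ∀ s ∉ tσ i, w (td i) (tσ i) < w (td i) (insert s (tσ i))
  notMem : ∀ d ∈ D, ∀ x ∈ L d, x.2 ∉ x.1
  card_lower : ∀ d ∈ D, ∀ x ∈ L d, x.1.card = k
  weight_le : ∀ d ∈ D, ∀ x ∈ L d, w d (insert x.2 x.1) ≤ raisedWeight w td tσ d x.1
  pairwise : ∀ d ∈ D, (L d).Pairwise fun x y => ¬ x.1 ⊆ insert y.2 y.1
  notMem' : ∀ d ∈ D, ∀ x ∈ L' d, x.2 ∉ x.1
  pairwise' : ∀ d ∈ D, (L' d).Pairwise fun x y => ¬ x.1 ⊆ insert y.2 y.1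
  cover : ∀ d ∈ D, ∀ σ : Finset B, σ.card = k →
    (∃ x ∈ L d, x.1 = σ) ∨ ∃ x ∈ L' d, insert x.2 x.1 = σ

/-- Cycles witnessing that the quotients attached to the cells `tσ i` are hit. -/
structure IsWitness (w : ℕ → Finset B → ℕ) (k : ℕ) {n : ℕ} (td : Fin n → ℕ)
    (tσ : Fin n → Finset B) (β : Fin n → Finset B → ℤ) : Prop where
  card_eq : ∀ i σ, bd (β i) σ ≠ 0 → σ.card = k
  weight_le : ∀ i σ, bd (β i) σ ≠ 0 → w (td i) σ ≤ w (td i) (tσ i)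
  isUnit : ∀ i, IsUnit (bd (β i) (tσ i))
  eq_zero : ∀ i j, j ≠ i → td j = td i → bd (β i) (tσ j) = 0

/-- The product of the `Φ_e ^ K` for `e ∈ D`, `e ≠ d`. -/
noncomputable def cofactor (D : Finset ℕ) (K d : ℕ) : R := ∏ e ∈ D.erase d, cyc e ^ K

lemma isCoprime_cyc_cofactor (D : Finset ℕ) (K d : ℕ) : IsCoprime (cyc d) (cofactor D K d) :=
  IsCoprime.prod_right fun _ he => (isCoprime_cyc (Finset.ne_of_mem_erase he).symm).pow_right

lemma HasWeights.cycProd_dvd_cofactor_mul (H : HasWeights cs D w K) {d : ℕ} (hd : d ∈ D)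
    {σ : Finset B} {a : R} (ha : cyc d ^ w d σ ∣ a) : cycProd D w σ ∣ cofactor D K d * a := by
  rw [cycProd_eq_mul hd, mul_comm]
  exact mul_dvd_mul (Finset.prod_dvd_prod_of_dvd _ _ fun e he =>
    pow_dvd_pow _ (H.lt e (Finset.mem_of_mem_erase he) σ).le) ha

lemma exists_sum_cofactor_eq_one (hD : D.Nonempty) (K : ℕ) :
    ∃ μ : ℕ → R, ∑ d ∈ D, μ d * cofactor D K d = 1 := by
  obtain ⟨μ, hμ⟩ := (exists_sum_eq_one_iff_pairwise_coprime (s := fun d => cyc d ^ K) hD).2 (by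
    intro a b hab
    exact (isCoprime_cyc fun h => hab (Subtype.ext h)).pow)
  refine ⟨μ, ?_⟩
  rw [← hμ]
  simp [cofactor, Finset.sdiff_singleton_eq_erase]

namespace HasWeights

lemma mem_range_bdry (H : HasWeights cs D w K) {td : Fin n → ℕ} {tσ : Fin n → Finset B}
    {L L' : ℕ → List (Finset B × B)} (hk : k + 1 < Fintype.card B)
    (hm : IsMatching D w k td tσ L L') (z : KW cs k → R) (hz : z ∈ cycles cs k)
    (htz : ∀ i, cyc (td i) * cycProd D w (tσ i) ∣ ch cs D w k z (tσ i)) :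
    z ∈ LinearMap.range (bdry cs k) := by
  have key : ∀ d ∈ D, cofactor D K d • z ∈ LinearMap.range (bdry cs k) := by
    intro d hd
    obtain ⟨b, hb1, hb2, hb3⟩ := exists_elimination (cyc d) (w d) (raisedWeight w td tσ d)
      (by
        intro τ t ht
        unfold raisedWeight
        split_ifs with h
        · obtain ⟨i, rfl, hi⟩ := h
          have := hm.lt_insert i t (by simp [hi])
          rwa [hi, Finset.insert_erase ht] at this
        · exact H.mono d hd τ t ht)
      (L d) (fun x hx => ⟨hm.notMem d hd x hx, hm.weight_le d hd x hx⟩) (hm.pairwise d hd)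
      (ch cs D w k z) (by
        intro σ
        have h1 : cyc d ^ w d σ ∣ cycProd D w σ := Dvd.intro _ (cycProd_eq_mul hd w σ).symm
        unfold raisedWeight
        split_ifs with h
        · obtain ⟨i, rfl, rfl⟩ := h
          rw [pow_succ']
          exact (mul_dvd_mul_left _ h1).trans (htz i)
        · exact h1.trans (cycProd_dvd_ch z σ))
    have hcard : ∀ τ, b τ ≠ 0 → τ.card = k + 1 := by
      intro τ hτ
      obtain ⟨x, hx, rfl⟩ := hb1 τ hτ
      rw [Finset.card_insert_of_notMem (hm.notMem d hd x hx), hm.card_lower d hd x hx]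
    have hzero : ch cs D w k z - bd b = 0 := by
      refine eq_zero_of_supported (L' d) (hm.notMem' d hd) (hm.pairwise' d hd) _ ?_ ?_
      · intro σ hσ
        have hσk : σ.card = k := by
          by_contra hne
          apply hσ
          rw [Pi.sub_apply, ch_of_not z fun h => hne h.1, zero_sub, neg_eq_zero]
          refine bd_eq_zero fun s hs => ?_
          by_contra h0
          have := hcard _ h0
          rw [Finset.card_insert_of_notMem hs] at this
          omega
        rcases hm.cover d hd σ hσk with ⟨x, hx, rfl⟩ | ⟨x, hx, rfl⟩
        · exact absurd (hb3 x hx) hσ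
        · exact ⟨x, hx, rfl⟩
      · intro x _
        rw [map_sub, bd_bd, H.mem_cycles_iff.1 hz, sub_zero, Pi.zero_apply]
    obtain ⟨y, hy⟩ := exists_ch_eq (cs := cs) (D := D) (w := w) (k := k + 1)
      (c := cofactor D K d • b) (by
        intro σ hσ
        have hc := hcard σ fun h => hσ (by rw [Pi.smul_apply, h, smul_zero])
        refine ⟨hc, (H.finite_iff σ).2 ?_⟩
        rintro rfl
        rw [Finset.card_univ] at hc
        omega) (fun σ => H.cycProd_dvd_cofactor_mul hd (hb2 σ))
    refine ⟨y, ch_injective (D := D) (w := w) k ?_⟩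
    rw [← H.bd_ch, hy, map_smul, map_smul, sub_eq_zero.1 hzero]
  obtain ⟨μ, hμ⟩ := exists_sum_cofactor_eq_one H.nonempty K
  rw [← one_smul R z, ← hμ, Finset.sum_smul]
  refine Submodule.sum_mem _ fun d hd => ?_
  rw [mul_smul]
  exact Submodule.smul_mem _ _ (key d hd)

lemma exists_cycle (H : HasWeights cs D w K) {td : Fin n → ℕ} {tσ : Fin n → Finset B}
    {L L' : ℕ → List (Finset B × B)} (hk : k < Fintype.card B)
    (hm : IsMatching D w k td tσ L L') {β : Fin n → Finset B → ℤ} (hβ : IsWitness w k td tσ β)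
    (i : Fin n) : ∃ z ∈ cycles cs k, (∀ hi, IsCoprime (cyc (td i)) (z ⟨tσ i, hi⟩)) ∧
      ∀ j ≠ i, ∀ hj, cyc (td j) ∣ z ⟨tσ j, hj⟩ := by
  set d := td i with hd
  have hdD : d ∈ D := hm.td_mem i
  have hsupp : ∀ σ, bd (fun τ => (β i τ : R)) σ ≠ 0 → bd (β i) σ ≠ 0 := by
    intro σ hσ h0
    rw [bd_intCast, h0, Int.cast_zero] at hσ
    exact hσ rfl
  obtain ⟨z, hz⟩ := exists_ch_eq (cs := cs) (D := D) (w := w) (k := k)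
    (c := (cofactor D K d * cyc d ^ w d (tσ i)) • bd fun τ => (β i τ : R)) (by
      intro σ hσ
      have h0 := hsupp σ fun h => hσ (by rw [Pi.smul_apply, h, smul_zero])
      have hc := hβ.card_eq i σ h0
      refine ⟨hc, (H.finite_iff σ).2 ?_⟩
      rintro rfl
      rw [Finset.card_univ] at hc
      omega) (by
      intro σ
      by_cases h0 : bd (fun τ => (β i τ : R)) σ = 0
      · rw [Pi.smul_apply, h0, smul_zero]
        exact dvd_zero _
      · rw [Pi.smul_apply, smul_eq_mul]
        exact Dvd.dvd.mul_right (H.cycProd_dvd_cofactor_mul hdD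
          (pow_dvd_pow _ (hβ.weight_le i σ (hsupp σ h0)))) _)
  have hval : ∀ j (hj : (tσ j).card = k ∧ (parabolic cs (tσ j) : Set W).Finite),
      cycProd D w (tσ j) * z ⟨tσ j, hj⟩ =
        cofactor D K d * cyc d ^ w d (tσ i) * ((bd (β i) (tσ j) : ℤ) : R) := by
    intro j hj
    rw [← ch_apply z ⟨tσ j, hj⟩, hz, Pi.smul_apply, smul_eq_mul, bd_intCast]
  refine ⟨z, ?_, ?_, ?_⟩
  · rw [H.mem_cycles_iff, hz, map_smul, bd_bd, smul_zero]
  · intro hi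
    have h1 := hval i hi
    rw [cycProd_eq_mul hdD] at h1
    have h2 : cycProd (D.erase d) w (tσ i) * z ⟨tσ i, hi⟩ =
        cofactor D K d * ((bd (β i) (tσ i) : ℤ) : R) := by
      refine mul_left_cancel₀ (pow_ne_zero (w d (tσ i)) (cyc_ne_zero d)) ?_
      rw [← mul_assoc, h1]
      ring
    have hu : IsUnit ((bd (β i) (tσ i) : ℤ) : R) := (hβ.isUnit i).map (Int.castRingHom R)
    have h3 : IsCoprime (cyc d) (cycProd (D.erase d) w (tσ i) * z ⟨tσ i, hi⟩) := by
      rw [h2]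
      exact (isCoprime_cyc_cofactor D K d).mul_right (isCoprime_one_right.of_isCoprime_of_dvd_right
        hu.dvd)
    exact h3.of_mul_right_right
  · intro j hji hj
    have h1 := hval j hj
    by_cases hdj : td j = d
    · rw [hβ.eq_zero i j hji hdj, Int.cast_zero, mul_zero] at h1
      rw [(mul_eq_zero.1 h1).resolve_left (cycProd_ne_zero D w _)]
      exact dvd_zero _
    · rw [cycProd_eq_mul (hm.td_mem j)] at h1
      have h2 : cyc (td j) ^ (w (td j) (tσ j) + 1) ∣ cofactor D K d :=
        (pow_dvd_pow _ (H.lt _ (hm.td_mem j) _)).trans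
          (Finset.dvd_prod_of_mem (fun e => cyc e ^ K)
            (Finset.mem_erase.2 ⟨hdj, hm.td_mem j⟩))
      have h3 : cyc (td j) ^ w (td j) (tσ j) * cyc (td j) ∣
          cyc (td j) ^ w (td j) (tσ j) * (cycProd (D.erase (td j)) w (tσ j) * z ⟨tσ j, hj⟩) := by
        rw [← mul_assoc, h1, ← pow_succ]
        exact (h2.mul_right _).mul_right _
      have h4 := (mul_dvd_mul_iff_left (pow_ne_zero _ (cyc_ne_zero (td j)))).1 h3
      exact (isCoprime_cyc_cycProd (Finset.notMem_erase _ _) w _).dvd_of_dvd_mul_left h4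

lemma cyc_dvd_bdry (H : HasWeights cs D w K) {td : Fin n → ℕ} {tσ : Fin n → Finset B}
    {L L' : ℕ → List (Finset B × B)} (hm : IsMatching D w k td tσ L L')
    (y : KW cs (k + 1) → R) (i : Fin n) (hi) : cyc (td i) ∣ bdry cs k y ⟨tσ i, hi⟩ := by
  have h1 := congrFun (H.bd_ch y) (tσ i)
  rw [ch_apply _ (⟨tσ i, hi⟩ : KW cs k)] at h1
  refine (mul_dvd_mul_iff_left (cycProd_ne_zero D w (tσ i))).1 ?_
  rw [← h1, bd_apply]
  refine Finset.dvd_sum fun s _ => ?_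
  split_ifs with hs
  · exact dvd_zero _
  refine Dvd.dvd.mul_left (Dvd.dvd.trans ?_ (cycProd_dvd_ch y (insert s (tσ i)))) _
  rw [cycProd_eq_mul (hm.td_mem i), cycProd_eq_mul (hm.td_mem i), mul_right_comm, ← pow_succ]
  exact mul_dvd_mul (pow_dvd_pow _ (hm.lt_insert i s hs))
    (cycProd_dvd fun d hd => H.mono_insert (Finset.mem_of_mem_erase hd) hs)

/-- The homology of the weighted complex in degree `k` is the direct sum of the cyclic modules
attached to the torsion cells of an acyclic matching. -/
theorem homology_equiv (H : HasWeights cs D w K) {td : Fin n → ℕ} {tσ : Fin n → Finset B}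
    {L L' : ℕ → List (Finset B × B)} (hk : k + 1 < Fintype.card B)
    (hm : IsMatching D w k td tσ L L') {β : Fin n → Finset B → ℤ} (hβ : IsWitness w k td tσ β) :
    Nonempty (Hgy cs k ≃ₗ[R] ∀ i, CycQuot (td i)) := by
  have hT : ∀ i, (tσ i).card = k ∧ (parabolic cs (tσ i) : Set W).Finite := by
    intro i
    refine ⟨hm.card_eq i, (H.finite_iff _).2 fun h => ?_⟩
    have := hm.card_eq i
    rw [h, Finset.card_univ] at this
    omega
  let F : cycles cs k →ₗ[R] ∀ i, CycQuot (td i) := LinearMap.pi fun i =>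
    (Submodule.mkQ (Ideal.span {cyc (td i)})) ∘ₗ (LinearMap.proj (⟨tσ i, hT i⟩ : KW cs k)) ∘ₗ
      (cycles cs k).subtype
  have hF : ∀ z i, F z i = Ideal.Quotient.mk (Ideal.span {cyc (td i)}) (z.1 ⟨tσ i, hT i⟩) :=
    fun _ _ => rfl
  have hker : LinearMap.ker F =
      Submodule.comap (cycles cs k).subtype (LinearMap.range (bdry cs k)) := by
    ext z
    rw [LinearMap.mem_ker, Submodule.mem_comap]
    constructor
    · intro hz
      refine H.mem_range_bdry hk hm z.1 z.2 fun i => ?_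
      have := hF z i
      rw [hz, Pi.zero_apply, eq_comm, Ideal.Quotient.eq_zero_iff_dvd] at this
      rw [ch_apply z.1 ⟨tσ i, hT i⟩, mul_comm]
      exact mul_dvd_mul_left _ this
    · rintro ⟨y, hy⟩
      funext i
      rw [hF, Pi.zero_apply, Ideal.Quotient.eq_zero_iff_dvd]
      have : z.1 = bdry cs k y := hy.symm
      rw [this]
      exact H.cyc_dvd_bdry hm y i _
  have hsurj : Function.Surjective F := by
    intro g
    choose z hz hz1 hz2 using fun i => H.exists_cycle (by omega) hm hβ i
    choose a ha using fun i => Ideal.Quotient.mk_surjective (g i)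
    choose u v huv using fun i => hz1 i (hT i)
    refine ⟨∑ i, (a i * v i) • ⟨z i, hz i⟩, ?_⟩
    funext j
    rw [map_sum, Finset.sum_apply, Finset.sum_eq_single j]
    · rw [map_smul, Pi.smul_apply, hF, ← ha j]
      change Ideal.Quotient.mk _ (a j * v j * z j ⟨tσ j, hT j⟩) = _
      rw [Ideal.Quotient.eq, Ideal.mem_span_singleton]
      refine ⟨- (a j * u j), ?_⟩
      linear_combination a j * huv j
    · intro i _ hij
      rw [map_smul, Pi.smul_apply, hF, (Ideal.Quotient.eq_zero_iff_dvd _ _).2 (hz2 i j hij.symm (hT j)),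
        smul_zero]
    · simp
  exact ⟨(Submodule.quotEquivOfEq _ _ hker.symm).trans (F.quotKerEquivOfSurjective hsurj)⟩

end HasWeights

end Torsion

section TopDegree

variable {B : Type*} [Fintype B] [LinearOrder B] {W : Type*} [Group W]
  {M : CoxeterMatrix B} {cs : CoxeterSystem M W}
  {D : Finset ℕ} {w : ℕ → Finset B → ℕ} {K : ℕ} {k : ℕ}

/-- Cycles of the simplex in top degree minus one are multiples of the boundary of the simplex. -/
lemma exists_eq_smul_bd_single {A : Type*} [CommRing A] [NoZeroDivisors A] [CharZero A]
    (hk : Fintype.card B = k + 1) {c : Finset B → A} (hc : ∀ σ, c σ ≠ 0 → σ.card = k)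
    (hcyc : bd c = 0) : ∃ a : A, c = a • bd (Pi.single Finset.univ (1 : A)) := by
  have : Nonempty B := Fintype.card_pos_iff.1 (by omega)
  obtain ⟨o⟩ := this
  have hins : insert o (Finset.univ.erase o) = Finset.univ :=
    Finset.insert_erase (Finset.mem_univ o)
  set ε : A := (-1) ^ ((Finset.univ.erase o).filter (· < o)).card with hε
  have hεε : ε * ε = 1 := by
    rw [hε, ← pow_add, ← two_mul, pow_mul]
    simp
  have hbo : bd (Pi.single Finset.univ (1 : A)) (Finset.univ.erase o) = ε := by
    have := bd_single (A := A) (Finset.notMem_erase o Finset.univ) 1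
    rw [hins, mul_one] at this
    exact this
  refine ⟨ε * c (Finset.univ.erase o), sub_eq_zero.1 ?_⟩
  set e := c - (ε * c (Finset.univ.erase o)) • bd (Pi.single Finset.univ (1 : A)) with he
  have heo : e (Finset.univ.erase o) = 0 := by
    rw [he, Pi.sub_apply, Pi.smul_apply, hbo, smul_eq_mul]
    linear_combination - c (Finset.univ.erase o) * hεε
  have hecard : ∀ σ, e σ ≠ 0 → σ.card = k := by
    intro σ hσ
    by_contra hne
    apply hσ
    rw [he, Pi.sub_apply, Pi.smul_apply, bd_eq_zero, smul_zero, sub_zero]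
    · by_contra h
      exact hne (hc σ h)
    · intro s hs
      refine Pi.single_eq_of_ne (fun h => hne ?_) _
      have := congrArg Finset.card h
      rw [Finset.card_insert_of_notMem hs, Finset.card_univ] at this
      omega
  refine eq_zero_of_supported
    ((Finset.univ.erase o).toList.map fun i => ((Finset.univ.erase i).erase o, o)) ?_ ?_ e ?_ ?_
  · intro x hx
    obtain ⟨i, -, rfl⟩ := List.mem_map.1 hx
    exact Finset.notMem_erase _ _
  · rw [List.pairwise_map]
    refine (Finset.nodup_toList (Finset.univ.erase o)).imp_of_mem ?_
    intro i j hi hj hij hsub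
    rw [Finset.mem_toList, Finset.mem_erase] at hi hj
    have : j ∈ (Finset.univ.erase i).erase o := by simp [hj.1, hij.symm]
    have := hsub this
    simp [hj.1] at this
  · intro σ hσ
    have h1 := hecard σ hσ
    have h2 : (Finset.univ \ σ).card = 1 := by
      rw [Finset.card_sdiff_of_subset (Finset.subset_univ _), Finset.card_univ]
      omega
    obtain ⟨i, hi⟩ := Finset.card_eq_one.1 h2
    have hσi : σ = Finset.univ.erase i := by
      rw [← Finset.sdiff_singleton_eq_erase, ← hi, Finset.sdiff_sdiff_eq_self
        (Finset.subset_univ _)]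
    have hio : i ≠ o := by
      rintro rfl
      exact hσ (hσi ▸ heo)
    refine ⟨_, List.mem_map.2 ⟨i, by simp [hio], rfl⟩, ?_⟩
    rw [hσi, Finset.insert_erase]
    simp [hio.symm]
  · intro x _
    rw [he, map_sub, map_smul, bd_bd, hcyc, smul_zero, sub_zero, Pi.zero_apply]

namespace HasWeights

lemma isEmpty_KW (H : HasWeights cs D w K) (hk : Fintype.card B ≤ k) : IsEmpty (KW cs k) := by
  refine ⟨fun σ => (H.finite_iff σ.1).1 σ.2.2 ?_⟩
  refine Finset.card_eq_iff_eq_univ _ |>.1 (le_antisymm (Finset.card_le_univ _) ?_)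
  rw [σ.2.1]
  exact hk

lemma subsingleton_homology (H : HasWeights cs D w K) (hk : Fintype.card B ≤ k) :
    Subsingleton (Hgy cs k) := by
  have := H.isEmpty_KW hk
  have : Subsingleton (cycles cs k) := inferInstance
  exact (Submodule.mkQ_surjective _).subsingleton

/-- The homology of the weighted complex in degree `|S| - 1` is free of rank one. -/
theorem homology_top (H : HasWeights cs D w K) (hk : Fintype.card B = k + 1) :
    Nonempty (Hgy cs k ≃ₗ[R] R) := by
  have hempty := H.isEmpty_KW (k := k + 1) hk.le
  have : Nonempty B := Fintype.card_pos_iff.1 (by omega)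
  set m : Finset B → R := bd (Pi.single Finset.univ 1) with hm
  have hmi : ∀ i, m (Finset.univ.erase i) * m (Finset.univ.erase i) = 1 := by
    intro i
    have := bd_single (A := R) (Finset.notMem_erase i Finset.univ) 1
    rw [Finset.insert_erase (Finset.mem_univ i), mul_one] at this
    rw [hm, this, ← pow_add, ← two_mul, pow_mul]
    simp
  have hms : ∀ σ, m σ ≠ 0 → ∃ i, σ = Finset.univ.erase i := by
    intro σ hσ
    by_contra hne
    refine hσ (bd_eq_zero fun s hs => Pi.single_eq_of_ne (fun h => hne ⟨s, ?_⟩) _)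
    rw [← h, Finset.erase_insert hs]
  set e : ℕ → ℕ := fun d => Finset.univ.sup fun i : B => w d (Finset.univ.erase i) with he
  set Q : R := ∏ d ∈ D, cyc d ^ e d with hQ
  have hQ0 : Q ≠ 0 := Finset.prod_ne_zero_iff.2 fun d _ => pow_ne_zero _ (cyc_ne_zero d)
  have hcard : ∀ i : B, (Finset.univ.erase i).card = k := by
    intro i
    rw [Finset.card_erase_of_mem (Finset.mem_univ i), Finset.card_univ, hk]
    rfl
  have hfin : ∀ i : B, (parabolic cs (Finset.univ.erase i) : Set W).Finite := fun i =>
    (H.finite_iff _).2 fun h => by simpa [h] using Finset.notMem_erase i Finset.univ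
  obtain ⟨z₀, hz₀⟩ := exists_ch_eq (cs := cs) (D := D) (w := w) (k := k) (c := Q • m) (by
      intro σ hσ
      obtain ⟨i, rfl⟩ := hms σ fun h => hσ (by rw [Pi.smul_apply, h, smul_zero])
      exact ⟨hcard i, hfin i⟩) (by
      intro σ
      by_cases h : m σ = 0
      · rw [Pi.smul_apply, h, smul_zero]
        exact dvd_zero _
      obtain ⟨i, rfl⟩ := hms σ h
      exact Dvd.dvd.mul_right (Finset.prod_dvd_prod_of_dvd _ _ fun d _ => pow_dvd_pow _
        (Finset.le_sup (f := fun i : B => w d (Finset.univ.erase i)) (Finset.mem_univ i))) _)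
  have hm0 : m ≠ 0 := by
    obtain ⟨i⟩ := this
    intro h
    have := hmi i
    simp [h] at this
  have hz₀0 : z₀ ≠ 0 := by
    rintro rfl
    rw [map_zero] at hz₀
    exact (smul_ne_zero hQ0 hm0) hz₀.symm
  have hz₀c : z₀ ∈ cycles cs k := by
    rw [H.mem_cycles_iff, hz₀, map_smul, hm, bd_bd, smul_zero]
  have hspan : ∀ z ∈ cycles cs k, ∃ a : R, z = a • z₀ := by
    intro z hz
    obtain ⟨a, ha⟩ := exists_eq_smul_bd_single hk (c := ch cs D w k z)
      (fun σ hσ => by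
        by_contra h
        exact hσ (ch_of_not z fun h' => h h'.1)) (H.mem_cycles_iff.1 hz)
    have hdvd : Q ∣ a := by
      refine Finset.prod_dvd_of_coprime (fun d _ d' _ hdd' => (isCoprime_cyc hdd').pow) ?_
      intro d hd
      obtain ⟨i, -, hi⟩ := Finset.exists_mem_eq_sup Finset.univ Finset.univ_nonempty
        (fun i : B => w d (Finset.univ.erase i))
      have h1 : cyc d ^ e d ∣ ch cs D w k z (Finset.univ.erase i) := by
        rw [he]
        simp only
        rw [hi]
        exact (Dvd.intro _ (cycProd_eq_mul hd w _).symm).trans (cycProd_dvd_ch z _)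
      rw [ha, Pi.smul_apply, smul_eq_mul] at h1
      have h2 := h1.mul_right (m (Finset.univ.erase i))
      rwa [mul_assoc, hmi, mul_one] at h2
    obtain ⟨b, rfl⟩ := hdvd
    refine ⟨b, ch_injective (D := D) (w := w) k ?_⟩
    rw [ha, map_smul, hz₀, smul_smul, mul_comm b]
  let F : R →ₗ[R] Hgy cs k :=
    (Submodule.mkQ _) ∘ₗ (LinearMap.toSpanSingleton R (cycles cs k) ⟨z₀, hz₀c⟩)
  refine ⟨(LinearEquiv.ofBijective F ⟨?_, ?_⟩).symm⟩
  · rw [← LinearMap.ker_eq_bot, LinearMap.ker_eq_bot']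
    intro a ha
    have h1 := (Submodule.Quotient.mk_eq_zero _).1 ha
    obtain ⟨y, hy⟩ := Submodule.mem_comap.1 h1
    have hy0 : y = 0 := Subsingleton.elim _ _
    rw [hy0, map_zero] at hy
    have h2 : a • z₀ = 0 := hy.symm
    exact (smul_eq_zero.1 h2).resolve_right hz₀0
  · intro x
    obtain ⟨z, rfl⟩ := Submodule.mkQ_surjective _ x
    obtain ⟨a, ha⟩ := hspan z.1 z.2
    exact ⟨a, congrArg _ (Subtype.ext ha.symm)⟩

end HasWeights

end TopDegree

section AffineE7

open Finset

/-- The multiplicity of `Φ_d` in the Poincaré polynomial of the parabolic subgroup with mask `m`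
is the `m`-th octal digit of the number paired with `d`. -/
def weightTable : List (ℕ × ℕ) :=
  [(2, 1551970602011962844272489050470470164610954396470259071461020667496056300841067495151346058041031590410937843728895665089054367798398574417647147939717193800692681369406442284695381364168295203616322624716335263162763906379883811400),
   (3, 1438158512247102734610858028240732232231576283785907032685678087724351254218428918838300468026996682402931075847502186478032111949693508393139583155512645186049538098860264745061586806719411034084865355309230573267286568859206681088),
   (4, 1413893637046407432300403371513446084473274501799024116724203493550962443131008485211775586440463310524935491599965524343037407927410701166280567255706922621712575939761767458516046789096235532979200309848454362933607333427599638528),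
   (5, 1386176868125632189861265528703233682960079984677948893801605935748174553959464762878258027175893797313390114571588144257220948076213534102369286086919023544578550639511734778246242685200181584004186337986694632780658513414285426688),
   (6, 1438104353143205612417089682031452544561518489953687657422395506331700108518630020397858297442770545720604839156285646446490636077969095162924881651392593078960020839365901138974751744136358344544780050897557583495558119080008351744),
   (7, 1382764727434012691068721313269476162353260056161588445531299624978486642777129981221846854292759736321860602763736196116219718068334280550333488310130981784271734928252426320919212748383819652896202964892344989579857848565348958208),
   (8, 1386170099683894083119314358335798256199667791832983177249035192108708520154976787078838139079327145100527280308968749870508636074527610380868957502871174692205706514943343935659724707594039208268103915435799315086898333969647927296),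
   (9, 1382711425955318895367059856911916338275664108994557919295718221366951629736304414388438582863013269424653135152132367615153684844763395794120082437029243291442302622222007127359464992070266481717742088788095823172525930161241063424),
   (10, 1386122720591721820273393063795745079241804727684511598372958968805376602415898254541695410265541542264568713774766688274784229529920844050871946248950005875471648518893325771650187282905236359131163916130244385167285772502651895808),
   (12, 1382711425955318895367059856911916338275664108994557919295718221366951629736304414388438582863013269424653135152132367615153684844763395794120082437029243291442302622222007127359464992070266481717742088788095823172525930161241063424),
   (14, 1382711425955318895367059856911916338275664108994557919295718221366951629736304414388438582863013269424653135152132366999497338026099658102260080872285277587071376521199402940667380550730863802073826285440185590595719042557678714880),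
   (18, 1382711425955318895367059856911916338275664108994557919295718221366951629736304414388438582863013269424653135152132366999497338026099658102260080872285277587071376521199402940667380550730863802073826285440185590595719042557678714880)]

/-- The node to be removed from the diagram with mask `m`, as octal digits. -/
def leafTable : ℕ :=
  172466096996881012310983191601244312239424521772956359711020681607231354987076477783395662526549931623075963209189869617077602369156763441444030521929065185436450811158823594096630628377619568141756294201728378028870732247921336384

/-- The type of the component from which the node is removed, as hexadecimal digits. -/
def typeTable : ℕ :=
  7750232640906145701355372936783471105783846069508049662681856105858724736047958979344234449031565995517580971307991009994024610274669512054529797741303420462968930783307281149875656406895345843113177109636505209136158370245912147375808800914583170378896612529884722488539903850944545301862030136728587603968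

/-- Acyclic matchings for the different `d`; the number `8 * m + s` encodes the cell with mask `m`
matched to the cell obtained by adding the vertex `s`. -/
def matchTable : List (ℕ × List ℕ) :=
  [(2, [5, 1030, 36, 9, 517, 19, 68, 133, 294, 326, 41, 1284, 100, 265, 76, 1062, 1155, 52, 1038,
    548, 521, 533, 1043, 276, 1094, 580, 137, 645, 147, 1300, 332, 1054, 1190, 1126, 422, 1294,
    1318, 777, 92, 297, 393, 307, 1078, 1555, 597, 108, 1163, 1796, 358, 340, 1667, 1070, 1348,
    1102, 454, 612, 588, 560, 116, 1171, 556, 169, 649, 661, 366, 1308, 1326, 430, 1086, 350,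
    1198, 809, 481, 438, 604, 1249, 1356, 1206, 1812, 1331, 819, 1364, 1116, 1382, 1182, 1422,
    1675, 1860, 1446, 1142, 628, 688, 1683, 844, 124, 725, 905, 1134, 620, 1342, 1214, 1505, 1150,
    1454, 1462, 1628, 1843, 1876, 1262, 1761, 1820, 382, 494, 993, 1390, 1868, 1372, 446, 478,
    636, 1278, 1470, 1406, 1884, 510, 1518, 2017]),
    (3, [2, 66, 257, 1026, 134, 513, 10, 18, 578, 194, 769, 385, 1152, 1538, 322, 31, 266, 87,
    142, 1035, 150, 522, 74, 166, 1042, 545, 1282, 1090, 289, 450, 834, 287, 1665, 1794, 1547,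
    422, 1344, 1554, 1602, 92, 1409, 586, 538, 1298, 330, 63, 1290, 159, 1187, 1067, 398, 179,
    338, 778, 801, 897, 1171, 1216, 214, 594, 119, 202, 706, 174, 1701, 346, 847, 466, 850, 962,
    463, 1563, 796, 1474, 1677, 667, 1362, 189, 415, 1802, 602, 1858, 1376, 319, 127, 1579, 1921,
    1418, 1810, 430, 1116, 1441, 1195, 714, 438, 1203, 691, 1729, 1618, 983, 863, 1370, 1490, 474,
    255, 970, 1213, 701, 831, 1820, 495, 1986, 879, 1691, 1738, 1709, 1595, 1761, 1717, 1874, 991,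
    895, 1498, 1994, 1015, 767, 1725]),
    (4, [6, 1026, 35, 260, 65, 128, 14, 22, 265, 1035, 1043, 78, 1283, 771, 289, 321, 276, 160,
    199, 46, 51, 1158, 640, 144, 30, 1538, 1090, 547, 577, 231, 1168, 1050, 213, 1067, 897, 90,
    1190, 1554, 182, 62, 448, 416, 672, 1408, 1291, 711, 299, 656, 207, 1166, 1794, 801, 110, 393,
    1547, 1602, 334, 777, 563, 787, 353, 1313, 1075, 1299, 481, 1232, 432, 1424, 1810, 960, 1856,
    1680, 1200, 1804, 722, 1922, 240, 1618, 190, 1472, 221, 1440, 928, 1306, 905, 1323, 350, 318,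
    811, 239, 1562, 719, 1198, 1377, 602, 1579, 865, 1114, 743, 1504, 1874, 1984, 1746, 992, 976,
    730, 1488, 1264, 1370, 489, 382, 1626, 1938, 1712, 1818, 1888, 944, 751, 1836, 1456, 1884,
    1754, 1946, 2002, 1520, 2016, 1008]),
    (5, [4, 70, 9, 39, 513, 20, 1028, 260, 79, 193, 322, 1090, 1541, 97, 45, 1044, 53, 295, 1036,
    86, 769, 268, 548, 640, 1284, 167, 276, 521, 137, 800, 704, 224, 205, 335, 455, 559, 1217,
    1072, 342, 1552, 181, 839, 563, 615, 1346, 1600, 1572, 585, 416, 1104, 175, 1300, 90, 111,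
    1664, 1052, 1549, 1069, 61, 897, 656, 1292, 777, 284, 727, 245, 688, 471, 1362, 1136, 223,
    743, 816, 928, 1923, 487, 1332, 1808, 1584, 1200, 1728, 368, 1308, 1248, 1229, 571, 1616, 350,
    960, 1680, 1440, 623, 367, 871, 189, 1824, 905, 847, 687, 730, 1840, 751, 255, 759, 1269, 495,
    983, 479, 1712, 1872, 1370, 1648, 1936, 880, 999, 1340, 879, 944, 1952, 1931, 1015, 1904, 511,
    991, 1754, 1007, 1968]),
    (6, [5, 33, 68, 15, 516, 1028, 129, 21, 295, 326, 1056, 545, 160, 576, 772, 76, 41, 391, 97,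
    535, 1281, 265, 1536, 524, 28, 143, 1092, 1044, 84, 1120, 224, 807, 1793, 417, 559, 395, 1348,
    449, 352, 679, 311, 329, 342, 777, 303, 788, 1569, 711, 663, 609, 1664, 105, 407, 1289, 592,
    543, 1076, 176, 1600, 1097, 1184, 1052, 1108, 92, 480, 247, 1248, 736, 960, 727, 719, 1141,
    617, 410, 1637, 865, 906, 1856, 1801, 431, 1616, 809, 368, 841, 1419, 319, 666, 1921, 575,
    1225, 929, 1376, 1441, 1353, 687, 1084, 1364, 823, 695, 759, 1648, 1760, 1872, 1645, 1984,
    976, 1929, 479, 1953, 1833, 735, 1690, 922, 1434, 992, 255, 873, 1149, 503, 1504, 2000, 1904,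
    2016, 1961, 1008, 511, 767]),
    (7, [3, 20, 130, 1026, 10, 37, 515, 259, 535, 28, 279, 87, 524, 52, 547, 1044, 1286, 141,
    1034, 647, 267, 74, 1539, 1155, 194, 1090, 101, 771, 386, 539, 287, 778, 1051, 311, 92, 60,
    588, 903, 658, 1546, 556, 407, 563, 1076, 1189, 1408, 173, 116, 1163, 1573, 675, 1291, 299,
    1098, 205, 1315, 803, 711, 1345, 342, 599, 791, 215, 450, 960, 914, 1680, 928, 1084, 720, 911,
    847, 346, 1699, 1589, 1248, 1197, 799, 1141, 1563, 1675, 1802, 819, 1610, 1323, 666, 372,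
    1637, 316, 571, 620, 124, 415, 1857, 1179, 439, 471, 1472, 237, 1955, 978, 1936, 1984, 992,
    1715, 922, 1595, 1744, 1707, 752, 1653, 1149, 827, 863, 1372, 474, 1269, 1504, 879, 1340,
    1968, 1963, 1723, 2000, 1277, 1851, 986]),
    (8, [6, 259, 1027, 70, 16, 36, 134, 14, 54, 1046, 292, 1060, 100, 1037, 772, 528, 44, 1540,
    1157, 1283, 548, 387, 267, 275, 84, 144, 142, 198, 78, 1072, 1549, 310, 1572, 791, 283, 1300,
    359, 112, 804, 779, 608, 1120, 1796, 1051, 1068, 403, 108, 556, 1316, 60, 300, 182, 1174, 94,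
    1110, 596, 1604, 1101, 1165, 656, 1221, 836, 395, 206, 796, 855, 1637, 368, 1328, 1182, 864,
    246, 1206, 367, 624, 316, 487, 1584, 1675, 1307, 411, 438, 1581, 736, 812, 1828, 1563, 1248,
    572, 1324, 1613, 1860, 907, 1136, 919, 1364, 1238, 1229, 222, 1648, 880, 1840, 1760, 1456,
    1438, 1645, 828, 1819, 860, 1392, 496, 1264, 1246, 983, 1214, 992, 1709, 254, 1931, 495, 1526,
    1904, 1776, 1008, 1968, 2016, 1502]),
    (9, [4, 1030, 36, 70, 16, 260, 12, 516, 97, 324, 528, 192, 151, 80, 79, 1094, 292, 1045, 551,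
    48, 47, 1060, 1158, 1286, 772, 1038, 524, 272, 268, 181, 1126, 1552, 352, 1109, 1222, 224,
    596, 213, 608, 1350, 1077, 105, 656, 304, 302, 336, 804, 836, 704, 1053, 332, 591, 157, 1294,
    1316, 407, 784, 560, 175, 679, 559, 1414, 780, 1166, 1478, 1136, 1382, 823, 1254, 1584, 741,
    624, 1134, 864, 688, 245, 191, 1232, 1680, 1205, 1118, 368, 1181, 480, 1085, 1621, 1358, 1422,
    1808, 1326, 430, 852, 1828, 844, 1230, 912, 687, 604, 221, 752, 880, 1488, 1648, 1504, 1392,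
    1390, 1264, 1486, 828, 1262, 253, 1374, 951, 860, 1936, 1744, 447, 1712, 1454, 749, 2000,
    1776, 2016, 1904, 1852, 1520, 1008]),
    (10, [5, 19, 36, 519, 15, 71, 1028, 133, 641, 143, 527, 151, 271, 79, 289, 531, 771, 321, 48,
    199, 102, 551, 279, 31, 1043, 47, 583, 1060, 1284, 783, 449, 801, 567, 207, 650, 675, 154,
    335, 711, 183, 300, 1350, 897, 175, 1665, 215, 231, 407, 353, 399, 1793, 423, 1552, 287, 787,
    539, 1313, 112, 1126, 110, 591, 95, 1072, 559, 905, 480, 841, 221, 367, 1382, 1321, 809, 316,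
    351, 463, 415, 961, 799, 1136, 714, 935, 1473, 1366, 246, 865, 439, 1825, 624, 727, 1616, 666,
    575, 1921, 695, 1178, 1674, 1699, 239, 1134, 1931, 1985, 969, 730, 1835, 993, 1738, 255, 503,
    1690, 937, 1504, 873, 383, 1270, 1449, 1865, 951, 1245, 1398, 1648, 2016, 1961, 1851, 1947,
    1754, 1001, 511]),
    (12, [1, 516, 133, 71, 1025, 13, 257, 33, 46, 167, 771, 545, 291, 523, 97, 1057, 577, 1540,
    193, 79, 1152, 532, 141, 149, 87, 327, 1033, 29, 1281, 173, 1795, 803, 59, 423, 93, 655, 307,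
    230, 673, 1546, 299, 899, 1315, 1067, 1571, 1411, 1121, 110, 183, 609, 1604, 1556, 1171, 705,
    1216, 541, 779, 205, 449, 787, 157, 335, 1289, 343, 1564, 487, 571, 914, 1083, 233, 687, 189,
    935, 315, 667, 1810, 605, 1923, 1197, 1417, 1827, 1249, 907, 439, 819, 1697, 1587, 1179, 719,
    246, 1803, 1620, 221, 1427, 811, 1331, 1323, 1610, 1117, 1628, 831, 494, 943, 999, 503, 1835,
    1596, 1820, 923, 699, 1931, 751, 983, 1481, 1938, 1761, 1874, 1257, 1213, 1339, 959, 895, 511,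
    1884, 1660, 1518, 1015]),
    (14, [6, 14, 263, 35, 70, 23, 1028, 134, 46, 270, 1540, 1036, 530, 387, 326, 770, 274, 295,
    144, 142, 51, 1060, 27, 163, 87, 1092, 547, 78, 198, 1100, 352, 329, 179, 1171, 1408, 202,
    1053, 416, 174, 214, 1290, 400, 398, 297, 286, 656, 1070, 1557, 59, 110, 1345, 1548, 539,
    1794, 342, 1298, 899, 594, 1572, 1075, 786, 1604, 1124, 675, 1441, 435, 1473, 1562, 464, 1353,
    931, 1114, 912, 1424, 871, 1178, 218, 1612, 190, 480, 1683, 462, 1857, 1618, 1085, 1132, 1589,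
    1920, 1377, 1203, 1636, 691, 1802, 809, 841, 368, 571, 714, 1198, 1939, 1715, 1819, 1691, 976,
    1626, 944, 1868, 1986, 1952, 1644, 1385, 939, 730, 1449, 443, 1505, 873, 887, 1481, 1242,
    1968, 1851, 1723, 1900, 1513, 1947, 1008]),
    (18, [0, 512, 16, 32, 135, 69, 256, 1024, 74, 1060, 100, 580, 1092, 548, 160, 528, 1284, 137,
    197, 85, 390, 151, 647, 274, 1536, 768, 1040, 288, 48, 1076, 1795, 94, 588, 596, 1556, 788,
    332, 656, 800, 400, 560, 1290, 836, 1299, 1098, 1348, 202, 1108, 1070, 1124, 1572, 612, 556,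
    210, 117, 1604, 1316, 356, 416, 282, 398, 655, 176, 1161, 1427, 628, 847, 1804, 1307, 1810,
    348, 1616, 1612, 127, 868, 1084, 1418, 1828, 928, 1354, 816, 1116, 1588, 688, 852, 466, 1331,
    364, 432, 1564, 1923, 1636, 1140, 1380, 620, 1226, 796, 1198, 222, 880, 860, 1888, 876, 1876,
    1342, 1836, 1820, 1938, 1435, 1459, 380, 975, 1482, 944, 1648, 1744, 636, 1644, 255, 1596,
    1776, 1904, 2016, 1404, 1884, 1470, 1008])]

/-- The indices `d` for which `Φ_d` divides some Poincaré polynomial. -/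
def cycIndices : List ℕ := [2, 3, 4, 5, 6, 7, 8, 9, 10, 12, 14, 18]

/-- The exponent of `Φ_d` in the Poincaré polynomial of the cell with mask `m`. -/
def maskWeight (d m : ℕ) : ℕ := (((weightTable.lookup d).getD 0) >>> (3 * m)) &&& 7

/-- The degrees of the graded pieces of the minuscule orbits in types
`A₁, …, A₇, D₄, D₅, D₆, E₆, E₇`, together with the cyclotomic factors of their generating
functions. -/
def orbitTypes : List (List ℕ × List ℕ) :=
  [(List.range 2, [2]), (List.range 3, [3]), (List.range 4, [2, 4]), (List.range 5, [5]),
    (List.range 6, [2, 3, 6]), (List.range 7, [7]), (List.range 8, [2, 4, 8]),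
    ([0, 1, 2, 3, 3, 4, 5, 6], [2, 6, 2, 4]),
    ([0, 1, 2, 3, 4, 4, 5, 6, 7, 8], [8, 5]),
    ([0, 1, 2, 3, 4, 5, 5, 6, 7, 8, 9, 10], [2, 10, 2, 3, 6]),
    ([0, 1, 2, 3, 4, 4, 5, 5, 6, 6, 7, 7, 8, 8, 8, 9, 9, 10, 10, 11, 11, 12, 12, 13, 14, 15, 16],
      [3, 6, 12, 3, 9]),
    ([0, 1, 2, 3, 4, 5, 5, 6, 6, 7, 7, 8, 8, 9, 9, 9, 10, 10, 10, 11, 11, 11, 12, 12, 12, 13, 13,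
      13, 14, 14, 14, 15, 15, 15, 16, 16, 16, 17, 17, 17, 18, 18, 18, 19, 19, 20, 20, 21, 21, 22,
      22, 23, 24, 25, 26, 27], [2, 10, 2, 6, 18, 2, 7, 14])]

lemma cyclotomic_mul_of_divisors {n : ℕ} (hn : 0 < n) {l : List ℕ}
    (hl : n.divisors.erase n = l.toFinset) (hd : l.Nodup) {p : ℚ[X]}
    (h : (l.map fun d => cyclotomic d ℚ).prod * p = X ^ n - 1) : cyclotomic n ℚ = p := by
  have h1 := prod_cyclotomic_eq_X_pow_sub_one hn ℚ
  rw [← Finset.mul_prod_erase _ _ (Nat.mem_divisors_self n hn.ne'), hl,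
    List.prod_toFinset _ hd, ← h, mul_comm] at h1
  refine mul_left_cancel₀ ?_ h1
  intro h0
  rw [h0, zero_mul] at h
  exact X_pow_sub_C_ne_zero hn (1 : ℚ) (by simpa using h.symm)

lemma cyclotomic_four_rat : cyclotomic 4 ℚ = X ^ 2 + 1 :=
  cyclotomic_mul_of_divisors (l := [1, 2]) (by norm_num) (by decide) (by decide) (by simp; ring)

lemma cyclotomic_five_rat : cyclotomic 5 ℚ = X ^ 4 + X ^ 3 + X ^ 2 + X + 1 :=
  cyclotomic_mul_of_divisors (l := [1]) (by norm_num) (by decide) (by decide) (by simp; ring)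

lemma cyclotomic_seven_rat : cyclotomic 7 ℚ = X ^ 6 + X ^ 5 + X ^ 4 + X ^ 3 + X ^ 2 + X + 1 :=
  cyclotomic_mul_of_divisors (l := [1]) (by norm_num) (by decide) (by decide) (by simp; ring)

lemma cyclotomic_eight_rat : cyclotomic 8 ℚ = X ^ 4 + 1 :=
  cyclotomic_mul_of_divisors (l := [1, 2, 4]) (by norm_num) (by decide) (by decide)
    (by simp [cyclotomic_four_rat]; ring)

lemma cyclotomic_nine_rat : cyclotomic 9 ℚ = X ^ 6 + X ^ 3 + 1 :=
  cyclotomic_mul_of_divisors (l := [1, 3]) (by norm_num) (by decide) (by decide) (by simp; ring)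

lemma cyclotomic_ten_rat : cyclotomic 10 ℚ = X ^ 4 - X ^ 3 + X ^ 2 - X + 1 :=
  cyclotomic_mul_of_divisors (l := [1, 2, 5]) (by norm_num) (by decide) (by decide)
    (by simp [cyclotomic_five_rat]; ring)

lemma cyclotomic_twelve_rat : cyclotomic 12 ℚ = X ^ 4 - X ^ 2 + 1 :=
  cyclotomic_mul_of_divisors (l := [1, 2, 3, 4, 6]) (by norm_num) (by decide) (by decide)
    (by simp [cyclotomic_four_rat]; ring)

lemma cyclotomic_fourteen_rat :
    cyclotomic 14 ℚ = X ^ 6 - X ^ 5 + X ^ 4 - X ^ 3 + X ^ 2 - X + 1 :=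
  cyclotomic_mul_of_divisors (l := [1, 2, 7]) (by norm_num) (by decide) (by decide)
    (by simp [cyclotomic_seven_rat]; ring)

lemma cyclotomic_eighteen_rat : cyclotomic 18 ℚ = X ^ 6 - X ^ 3 + 1 :=
  cyclotomic_mul_of_divisors (l := [1, 2, 3, 6, 9]) (by norm_num) (by decide) (by decide)
    (by simp [cyclotomic_nine_rat]; ring)

lemma orbitTypes_sum : ∀ x ∈ orbitTypes,
    (x.1.map fun l => (X : ℚ[X]) ^ l).sum = (x.2.map fun d => cyclotomic d ℚ).prod := by
  simp only [orbitTypes, List.forall_mem_cons, List.range_succ, List.range_zero, List.map_cons,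
    List.map_append, List.map_nil, List.sum_append, List.sum_cons, List.sum_nil, List.prod_cons,
    List.prod_nil,
    cyclotomic_two, cyclotomic_three, cyclotomic_four_rat, cyclotomic_five_rat,
    cyclotomic_six, cyclotomic_seven_rat, cyclotomic_eight_rat, cyclotomic_nine_rat,
    cyclotomic_ten_rat, cyclotomic_twelve_rat, cyclotomic_fourteen_rat, cyclotomic_eighteen_rat]
  refine ⟨?_, ?_, ?_, ?_, ?_, ?_, ?_, ?_, ?_, ?_, ?_, ?_, by simp⟩ <;> ring

/-- The set of nodes with mask `m`. -/
def ofMask (m : ℕ) : Finset (Fin 8) := univ.filter fun i => m.testBit i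

/-- The mask of a set of nodes. -/
def mask (σ : Finset (Fin 8)) : ℕ := ∑ i ∈ σ, 2 ^ i.val

lemma mask_bits : ∀ σ : Finset (Fin 8), (∀ i : Fin 8, (mask σ).testBit i = decide (i ∈ σ)) ∧
    mask σ < 256 := by
  decide +kernel

lemma testBit_mask {σ : Finset (Fin 8)} {i : Fin 8} : (mask σ).testBit i = true ↔ i ∈ σ := by
  rw [(mask_bits σ).1, decide_eq_true_iff]

lemma mask_lt (σ : Finset (Fin 8)) : mask σ < 256 := (mask_bits σ).2

lemma ofMask_mask (σ : Finset (Fin 8)) : ofMask (mask σ) = σ := by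
  ext i
  simp [ofMask, testBit_mask]

lemma mask_ofMask {m : ℕ} (hm : m < 256) : mask (ofMask m) = m := by
  have : ∀ m ∈ List.range 256, mask (ofMask m) = m := by decide +kernel
  exact this m (List.mem_range.2 hm)

lemma mask_insert {σ : Finset (Fin 8)} {s : Fin 8} (hs : s ∉ σ) :
    mask (insert s σ) = mask σ + 2 ^ s.val := by
  rw [mask, sum_insert hs, add_comm, mask]

lemma mask_erase {σ : Finset (Fin 8)} {s : Fin 8} (hs : s ∈ σ) :
    mask (σ.erase s) = mask σ - 2 ^ s.val := by
  rw [mask, mask, ← sum_erase_add σ _ hs, Nat.add_sub_cancel]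

lemma mem_ofMask {m : ℕ} {i : Fin 8} : i ∈ ofMask m ↔ m.testBit i = true := by
  simp [ofMask]

/-- Adjacency in the affine Dynkin diagram of type `E₇`. -/
def adjE7 (i j : Fin 8) : Bool :=
  (i.val, j.val) ∈ [(0, 1), (1, 3), (2, 4), (3, 4), (4, 5), (5, 6), (6, 7),
    (1, 0), (3, 1), (4, 2), (4, 3), (5, 4), (6, 5), (7, 6)]

/-- The `t`-th hexadecimal digit. -/
def hexDigit (c t : ℕ) : ℕ := (c >>> (4 * t)) &&& 15

/-- The vector whose coordinates are encoded by the first eight hexadecimal digits, with offset `8`;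
the higher digits encode the degree of the vector in its orbit. -/
def decodeVec (c : ℕ) (t : Fin 8) : ℤ := (hexDigit c t : ℤ) - 8

/-- The degree of an encoded vector. -/
def codeDegree (c : ℕ) : ℕ := c >>> 32

/-- The sum of `16 ^ t` over the neighbours `t` of `i`. -/
def neighbourCode (i : Fin 8) : ℕ :=
  ∑ t, if adjE7 i t then 16 ^ t.val else 0

/-- The code of the reflection of an encoded vector in a simple reflection, provided that the
corresponding coordinate is `-1`, `0` or `1`. -/
def reflCode (i : Fin 8) (c : ℕ) : ℕ :=
  match hexDigit c i with
  | 7 => c + 2 * 16 ^ i.val - (2 ^ 32 + neighbourCode i)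
  | 9 => c + 2 ^ 32 + neighbourCode i - 2 * 16 ^ i.val
  | _ => c

/-- Whether `c'` encodes the reflection of the vector encoded by `c`. -/
def isReflCode (i : Fin 8) (c c' : ℕ) : Bool :=
  (List.finRange 8).all fun t =>
    if t = i then hexDigit c' t + hexDigit c t == 16
    else if adjE7 i t then hexDigit c' t + 8 == hexDigit c t + hexDigit c i
    else hexDigit c' t == hexDigit c t

/-- The codes of the vectors in the orbit, starting from those in one degree. -/
def orbitFrom (I : List (Fin 8)) : ℕ → List ℕ → List ℕ
  | 0, _ => []
  | n + 1, l => l ++ orbitFrom I n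
      ((l.flatMap fun c => (I.filter fun i : Fin 8 => hexDigit c i.val == 9).map fun i => reflCode i c).dedup)

/-- The code of the vector which vanishes on `J` and is `1` elsewhere. -/
def startCode (J : ℕ) : ℕ :=
  ∑ t : Fin 8, if J.testBit t then 8 * 16 ^ t.val else 9 * 16 ^ t.val

/-- The nodes with mask `m`. -/
def nodes (m : ℕ) : List (Fin 8) := (List.finRange 8).filter fun i => m.testBit i

/-- The node removed from the diagram with mask `m`. -/
def leafNode (m : ℕ) : Fin 8 := Fin.ofNat 8 ((leafTable >>> (3 * m)) &&& 7)

/-- The type of the component of the removed node. -/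
def orbitType (m : ℕ) : List ℕ × List ℕ :=
  (orbitTypes[(typeTable >>> (4 * m)) &&& 15]?).getD ([], [])

/-- The orbit of the start vector under the parabolic subgroup with mask `m`. -/
def orbitCodes (m : ℕ) : List ℕ :=
  orbitFrom (nodes m) 28 [startCode (m - 2 ^ (leafNode m).val)]

/-- The properties of the orbit needed to compute the Poincaré polynomial. -/
def orbitCheck (m : ℕ) : Bool :=
  let O := orbitCodes m
  let s := startCode (m - 2 ^ (leafNode m).val)
  m.testBit (leafNode m) &&
  (O.map (· % 2 ^ 32)).Nodup &&
  (O.map codeDegree == (orbitType m).1) &&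
  O.all (fun c =>
    ((nodes m).all fun i =>
      O.contains (reflCode i c) && isReflCode i c (reflCode i c)) &&
    (c == s || (nodes m).any fun i =>
      decide (hexDigit c i < 8) && codeDegree (reflCode i c) + 1 == codeDegree c)) &&
  cycIndices.all fun d =>
    maskWeight d m == maskWeight d (m - 2 ^ (leafNode m).val) + (orbitType m).2.count d

lemma orbitCheck_eq_true : ∀ m ∈ List.range 255, m ≠ 0 → orbitCheck m = true := by
  decide +kernel

lemma hexDigit_startCode : ∀ J ∈ List.range 256, codeDegree (startCode J) = 0 ∧
    ∀ t : Fin 8, hexDigit (startCode J) t = if J.testBit t then 8 else 9 := by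
  decide +kernel

lemma decodeVec_injOn {c c' : ℕ} (h : decodeVec c = decodeVec c') : c % 2 ^ 32 = c' % 2 ^ 32 := by
  have hdig : ∀ t : Fin 8, c / 2 ^ (4 * t.val) % 2 ^ 4 = c' / 2 ^ (4 * t.val) % 2 ^ 4 := by
    intro t
    have ht := congrFun h t
    simp only [decodeVec, hexDigit, sub_left_inj, Nat.cast_inj] at ht
    rw [show 15 = 2 ^ 4 - 1 from rfl, Nat.and_two_pow_sub_one_eq_mod,
      Nat.and_two_pow_sub_one_eq_mod, Nat.shiftRight_eq_div_pow, Nat.shiftRight_eq_div_pow] at ht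
    exact ht
  have h0 := hdig 0
  have h1 := hdig 1
  have h2 := hdig 2
  have h3 := hdig 3
  have h4 := hdig 4
  have h5 := hdig 5
  have h6 := hdig 6
  have h7 := hdig 7
  simp at h0 h1 h2 h3 h4 h5 h6 h7
  omega

lemma decodeVec_of_isReflCode {i : Fin 8} {c c' : ℕ} (h : isReflCode i c c' = true) :
    decodeVec c' = dualRefl adjE7 i (decodeVec c) := by
  funext t
  have ht := List.all_eq_true.1 h t (List.mem_finRange t)
  rw [dualRefl_apply]
  unfold decodeVec
  split_ifs at ht ⊢ with h1 h2
  · subst h1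
    have := beq_iff_eq.1 ht
    omega
  · have := beq_iff_eq.1 ht
    omega
  · have := beq_iff_eq.1 ht
    omega

variable {W : Type*} [Group W] {Mat : CoxeterMatrix (Fin 8)} (cs : CoxeterSystem Mat W)

lemma poin_empty : (parabolic cs ∅ : Set W).Finite ∧ poin cs ∅ = 1 := by
  have h : (parabolic cs ∅ : Set W) = {1} := by simp [parabolic]
  have hf : (parabolic cs ∅ : Set W).Finite := by
    rw [h]
    exact Set.finite_singleton 1
  refine ⟨hf, ?_⟩
  rw [poin, dif_pos hf]
  have : hf.toFinset = {1} := by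
    ext w
    rw [Set.Finite.mem_toFinset, h]
    simp
  rw [this, sum_singleton, cs.length_one, pow_zero]

lemma poin_step (h : IsSimplyLaced Mat adjE7) {m : ℕ} (hm : m < 255) (hm0 : m ≠ 0)
    (hfin : (parabolic cs (ofMask (m - 2 ^ (leafNode m).val)) : Set W).Finite) :
    (parabolic cs (ofMask m) : Set W).Finite ∧
      poin cs (ofMask m) = ((orbitType m).2.map fun d => cyclotomic d ℚ).prod *
        poin cs (ofMask (m - 2 ^ (leafNode m).val)) := by
  classical
  have hcheck := orbitCheck_eq_true m (List.mem_range.2 hm) hm0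
  simp only [orbitCheck, Bool.and_eq_true, List.all_eq_true, decide_eq_true_iff, Bool.or_eq_true,
    beq_iff_eq, List.any_eq_true, List.contains_iff_mem] at hcheck
  obtain ⟨⟨⟨⟨hleaf, hnodup⟩, hdeg⟩, horb⟩, -⟩ := hcheck
  set l := leafNode m
  set O := orbitCodes m with hO
  set J := m - 2 ^ l.val with hJ
  have hJmask : ofMask J = (ofMask m).erase l := by
    rw [← ofMask_mask ((ofMask m).erase l), mask_erase (mem_ofMask.2 hleaf),
      mask_ofMask (by omega)]
  have hnodes : ∀ i, i ∈ ofMask m → i ∈ nodes m := by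
    intro i hi
    simpa [nodes] using mem_ofMask.1 hi
  have hnodes' : ∀ i, i ∈ nodes m → i ∈ ofMask m := by
    intro i hi
    rw [mem_ofMask]
    simpa [nodes] using hi
  have hstart : startCode J ∈ O := by
    rw [hO, orbitCodes, orbitFrom]
    simp [hJ, l]
  obtain ⟨hs0, hsdig⟩ := hexDigit_startCode J
    (List.mem_range.2 ((Nat.sub_le _ _).trans_lt (by omega)))
  have hinj : ∀ c ∈ O, ∀ c' ∈ O, decodeVec c = decodeVec c' → c = c' :=
    fun c hc c' hc' hcc => List.inj_on_of_nodup_map hnodup hc hc' (decodeVec_injOn hcc)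
  set lev : (Fin 8 → ℤ) → ℕ := fun v =>
    if hv : ∃ c ∈ O, decodeVec c = v then codeDegree hv.choose else 0 with hlevdef
  have hlev : ∀ c ∈ O, lev (decodeVec c) = codeDegree c := by
    intro c hc
    have hv : ∃ c' ∈ O, decodeVec c' = decodeVec c := ⟨c, hc, rfl⟩
    rw [hlevdef]
    simp only
    rw [dif_pos hv, hinj _ hv.choose_spec.1 c hc hv.choose_spec.2]
  obtain ⟨hf, hp⟩ := poin_eq_orbit_sum cs h (I := ofMask m) (J := ofMask J)
    (v₀ := decodeVec (startCode J)) (hJmask ▸ erase_subset _ _)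
    (by
      intro t
      rw [decodeVec, hsdig]
      split_ifs <;> norm_num)
    (by
      intro t
      rw [decodeVec, hsdig, mem_ofMask]
      split_ifs with ht <;> simp [ht])
    hfin (O.toFinset.image decodeVec) lev
    (mem_image_of_mem _ (List.mem_toFinset.2 hstart))
    (by rw [hlev _ hstart, hs0])
    (by
      intro v hv i hi
      obtain ⟨c, hc, rfl⟩ := mem_image.1 hv
      rw [List.mem_toFinset] at hc
      obtain ⟨h1, h2⟩ := (horb c hc).1 i (hnodes i hi)
      rw [← decodeVec_of_isReflCode h2]
      exact mem_image_of_mem _ (List.mem_toFinset.2 h1))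
    (by
      intro v hv hv0
      obtain ⟨c, hc, rfl⟩ := mem_image.1 hv
      rw [List.mem_toFinset] at hc
      obtain ⟨i, hi, h1, h2⟩ := (horb c hc).2.resolve_left fun e => hv0 (congrArg _ e)
      obtain ⟨h3, h4⟩ := (horb c hc).1 i hi
      refine ⟨i, hnodes' i hi, ?_, ?_⟩
      · rw [decodeVec]
        omega
      · rw [← decodeVec_of_isReflCode h4, hlev _ h3, hlev _ hc, h2])
  refine ⟨hf, ?_⟩
  rw [hp]
  congr 1
  rw [sum_image (fun c hc c' hc' => hinj c (List.mem_toFinset.1 hc) c' (List.mem_toFinset.1 hc')),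
    sum_congr rfl fun c hc => by rw [hlev c (List.mem_toFinset.1 hc)],
    List.sum_toFinset _ (hnodup.of_map _)]
  have hne : (orbitType m).1 ≠ [] := by
    rw [← hdeg]
    intro he
    rw [List.map_eq_nil_iff] at he
    rw [he] at hstart
    exact List.not_mem_nil hstart
  have hmem : orbitType m ∈ orbitTypes := by
    unfold orbitType at hne ⊢
    cases he : orbitTypes[(typeTable >>> (4 * m)) &&& 15]? with
    | none => simp [he] at hne
    | some x =>
      rw [Option.getD_some]
      exact List.mem_of_getElem? he
  rw [← orbitTypes_sum _ hmem, ← hdeg, List.map_map]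
  rfl

/-- The indices `d` for which `Φ_d` divides some Poincaré polynomial, as a set. -/
def cycFinset : Finset ℕ := cycIndices.toFinset

lemma poin_ofMask (h : IsSimplyLaced Mat adjE7) (m : ℕ) (hm : m < 255) :
    (parabolic cs (ofMask m) : Set W).Finite ∧
      poin cs (ofMask m) = ∏ d ∈ cycFinset, cyclotomic d ℚ ^ maskWeight d m := by
  induction m using Nat.strong_induction_on with
  | _ m ih =>
  by_cases hm0 : m = 0
  · subst hm0
    have h0 : ofMask 0 = ∅ := by simp [ofMask]
    rw [h0]
    refine ⟨(poin_empty cs).1, ?_⟩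
    rw [(poin_empty cs).2]
    refine (prod_eq_one fun d hd => ?_).symm
    have : ∀ d ∈ cycFinset, maskWeight d 0 = 0 := by decide +kernel
    rw [this d hd, pow_zero]
  · have hcheck := orbitCheck_eq_true m (List.mem_range.2 hm) hm0
    simp only [orbitCheck, Bool.and_eq_true, List.all_eq_true, beq_iff_eq] at hcheck
    have hpos : 0 < 2 ^ (leafNode m).val := by positivity
    obtain ⟨hf, hp⟩ := ih (m - 2 ^ (leafNode m).val) (by omega) (by omega)
    obtain ⟨hf', hp'⟩ := poin_step cs h hm hm0 hf
    refine ⟨hf', ?_⟩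
    have hsub : (orbitType m).2.toFinset ⊆ cycFinset := by
      have : ∀ m ∈ List.range 255, (orbitType m).2.toFinset ⊆ cycFinset := by decide +kernel
      exact this m (List.mem_range.2 hm)
    rw [hp', hp, prod_list_map_count, prod_subset hsub, ← prod_mul_distrib]
    · refine prod_congr rfl fun d hd => ?_
      rw [hcheck.2 d (List.mem_toFinset.1 hd), add_comm, pow_add]
    · intro d _ hd
      rw [List.count_eq_zero_of_not_mem (by simpa using hd), pow_zero]

lemma mask_eq_255 {σ : Finset (Fin 8)} (h : mask σ = 255) : σ = univ := by
  rw [← ofMask_mask σ, h]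
  decide +kernel

/-- The exponent of `Φ_d` in the Poincaré polynomial of `W_σ`. -/
def weightE7 (d : ℕ) (σ : Finset (Fin 8)) : ℕ := maskWeight d (mask σ)

lemma weightE7_lt (d : ℕ) (σ : Finset (Fin 8)) : weightE7 d σ < 8 :=
  Nat.lt_succ_of_le Nat.and_le_right

theorem hasWeights_E7 (h : IsSimplyLaced Mat adjE7) : HasWeights cs cycFinset weightE7 8 where
  nonempty := ⟨2, by decide⟩
  finite_iff σ := by
    refine ⟨?_, fun hσ => ?_⟩
    · rintro hf rfl
      refine not_finite_parabolic_univ cs h ![1, 2, 2, 3, 4, 3, 2, 1] ?_ ?_ hf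
      · intro i v
        fin_cases i <;> simp [Fin.sum_univ_succ, dualRefl_apply, adjE7] <;> ring
      · decide
    · have := (poin_ofMask cs h (mask σ) (lt_of_le_of_ne (Nat.le_of_lt_succ (mask_lt σ))
        fun e => hσ (mask_eq_255 e))).1
      rwa [ofMask_mask] at this
  poin_eq σ hσ := by
    have := (poin_ofMask cs h (mask σ) (lt_of_le_of_ne (Nat.le_of_lt_succ (mask_lt σ))
      fun e => hσ (mask_eq_255 e))).2
    rwa [ofMask_mask] at this
  mono d hd σ t ht := by
    have hmono : ∀ d ∈ cycFinset, ∀ m ∈ List.range 256, ∀ t : Fin 8, m.testBit t = true →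
        maskWeight d (m - 2 ^ t.val) ≤ maskWeight d m := by decide +kernel
    rw [weightE7, weightE7, mask_erase ht]
    exact hmono d hd _ (List.mem_range.2 (mask_lt σ)) t (testBit_mask.2 ht)
  lt d _ σ := weightE7_lt d σ

/-- The number of nodes of a mask. -/
def maskCard (m : ℕ) : ℕ := (nodes m).length

lemma maskCard_mask (σ : Finset (Fin 8)) : maskCard (mask σ) = σ.card := by
  revert σ
  decide +kernel

/-- The pairs of the matching for `d` with lower cell in degree `k`. -/
def matching (d k : ℕ) : List (ℕ × Fin 8) :=
  (((matchTable.lookup d).getD []).map fun n => (n / 8, Fin.ofNat 8 n)).filter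
    fun x => maskCard x.1 == k

/-- The pairs of the matching for `d` with upper cell in degree `k`. -/
def matchingBelow (d : ℕ) : ℕ → List (ℕ × Fin 8)
  | 0 => []
  | k + 1 => matching d k

/-- The pair of a subset and a node encoded by a pair of a mask and a node. -/
def ofMaskPair (x : ℕ × Fin 8) : Finset (Fin 8) × Fin 8 := (ofMask x.1, x.2)

/-- The mask of the upper cell of a pair of a matching. -/
def upperMask (x : ℕ × Fin 8) : ℕ := x.1 + 2 ^ x.2.val

/-- Whether the masks of a list of pairs form an acyclic matching. -/
def AcyclicMasks (L : List (ℕ × Fin 8)) : Prop :=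
  (∀ x ∈ L, x.1 < 256 ∧ x.1.testBit x.2 = false) ∧ L.Pairwise fun x y => x.1 &&& upperMask y ≠ x.1

instance (L : List (ℕ × Fin 8)) : Decidable (AcyclicMasks L) :=
  inferInstanceAs (Decidable (_ ∧ _))

lemma mask_and_of_subset {σ τ : Finset (Fin 8)} (h : σ ⊆ τ) : mask σ &&& mask τ = mask σ := by
  refine Nat.eq_of_testBit_eq fun i => ?_
  rw [Nat.testBit_and]
  by_cases hi : i < 8
  · have h1 := @testBit_mask σ ⟨i, hi⟩
    have h2 := @testBit_mask τ ⟨i, hi⟩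
    cases hs : (mask σ).testBit i
    · rfl
    · rw [Bool.true_and]
      exact h2.2 (h (h1.1 hs))
  · have h8 : 2 ^ 8 ≤ 2 ^ i := Nat.pow_le_pow_right (by norm_num) (not_lt.1 hi)
    rw [Nat.testBit_lt_two_pow ((mask_lt σ).trans_le h8), Bool.false_and]

lemma insert_ofMask {x : ℕ × Fin 8} (hx : x.1 < 256) (hb : x.1.testBit x.2 = false) :
    mask (insert x.2 (ofMask x.1)) = upperMask x := by
  rw [mask_insert (by simp [mem_ofMask, hb]), mask_ofMask hx, upperMask]

lemma AcyclicMasks.notMem {L : List (ℕ × Fin 8)} (hL : AcyclicMasks L) :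
    ∀ x ∈ L.map ofMaskPair, x.2 ∉ x.1 := by
  intro x hx
  obtain ⟨y, hy, rfl⟩ := List.mem_map.1 hx
  simp [ofMaskPair, mem_ofMask, (hL.1 y hy).2]

lemma AcyclicMasks.pairwise {L : List (ℕ × Fin 8)} (hL : AcyclicMasks L) :
    (L.map ofMaskPair).Pairwise fun x y => ¬ x.1 ⊆ insert y.2 y.1 := by
  rw [List.pairwise_map]
  refine hL.2.imp_of_mem ?_
  intro x y hx hy hxy hsub
  apply hxy
  have := mask_and_of_subset hsub
  rwa [ofMaskPair, ofMaskPair, insert_ofMask (hL.1 y hy).1 (hL.1 y hy).2,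
    mask_ofMask (hL.1 x hx).1] at this

/-- The conditions on masks expressing `IsMatching`. -/
structure IsMaskMatching (k : ℕ) {n : ℕ} (td tm : Fin n → ℕ) : Prop where
  td_mem : ∀ i, td i ∈ cycFinset
  card_eq : ∀ i, tm i < 256 ∧ maskCard (tm i) = k
  lt_insert : ∀ i, ∀ s : Fin 8, (tm i).testBit s = false →
    maskWeight (td i) (tm i) < maskWeight (td i) (tm i + 2 ^ s.val)
  acyclic : ∀ d ∈ cycFinset, AcyclicMasks (matching d k)
  acyclic' : ∀ d ∈ cycFinset, AcyclicMasks (matchingBelow d k)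
  weight_le : ∀ d ∈ cycFinset, ∀ x ∈ matching d k, maskWeight d (upperMask x) ≤ maskWeight d x.1 ∨
    ((∃ i, td i = d ∧ tm i = x.1) ∧ maskWeight d (upperMask x) ≤ maskWeight d x.1 + 1)
  cover : ∀ d ∈ cycFinset, ∀ m ∈ List.range 256, maskCard m = k →
    m ∈ (matching d k).map Prod.fst ∨ m ∈ (matchingBelow d k).map upperMask

lemma isMaskMatching_iff (k : ℕ) {n : ℕ} (td tm : Fin n → ℕ) : IsMaskMatching k td tm ↔
    (∀ i, td i ∈ cycFinset) ∧ (∀ i, tm i < 256 ∧ maskCard (tm i) = k) ∧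
    (∀ i, ∀ s : Fin 8, (tm i).testBit s = false →
      maskWeight (td i) (tm i) < maskWeight (td i) (tm i + 2 ^ s.val)) ∧
    (∀ d ∈ cycFinset, AcyclicMasks (matching d k)) ∧
    (∀ d ∈ cycFinset, AcyclicMasks (matchingBelow d k)) ∧
    (∀ d ∈ cycFinset, ∀ x ∈ matching d k, maskWeight d (upperMask x) ≤ maskWeight d x.1 ∨
      ((∃ i, td i = d ∧ tm i = x.1) ∧ maskWeight d (upperMask x) ≤ maskWeight d x.1 + 1)) ∧
    ∀ d ∈ cycFinset, ∀ m ∈ List.range 256, maskCard m = k →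
      m ∈ (matching d k).map Prod.fst ∨ m ∈ (matchingBelow d k).map upperMask :=
  ⟨fun ⟨a, b, c, d, e, f, g⟩ => ⟨a, b, c, d, e, f, g⟩, fun ⟨a, b, c, d, e, f, g⟩ =>
    ⟨a, b, c, d, e, f, g⟩⟩

instance (k : ℕ) {n : ℕ} (td tm : Fin n → ℕ) : Decidable (IsMaskMatching k td tm) :=
  decidable_of_iff' _ (isMaskMatching_iff k td tm)

lemma IsMaskMatching.isMatching {k n : ℕ} {td tm : Fin n → ℕ} (h : IsMaskMatching k td tm) :
    IsMatching cycFinset weightE7 k td (fun i => ofMask (tm i))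
      (fun d => (matching d k).map ofMaskPair)
      (fun d => (matchingBelow d k).map ofMaskPair) where
  td_mem := h.td_mem
  card_eq i := by rw [← maskCard_mask, mask_ofMask (h.card_eq i).1, (h.card_eq i).2]
  lt_insert i s hs := by
    have hb : (tm i).testBit s = false := by simpa [mem_ofMask] using hs
    have := h.lt_insert i s hb
    rw [weightE7, weightE7, mask_insert hs, mask_ofMask (h.card_eq i).1]
    exact this
  notMem d hd := (h.acyclic d hd).notMem
  card_lower d hd x hx := by
    obtain ⟨y, hy, rfl⟩ := List.mem_map.1 hx
    have hy' := (List.mem_filter.1 hy).2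
    rw [ofMaskPair, ← maskCard_mask, mask_ofMask ((h.acyclic d hd).1 y hy).1]
    exact beq_iff_eq.1 hy'
  weight_le d hd x hx := by
    obtain ⟨y, hy, rfl⟩ := List.mem_map.1 hx
    have hy' := (h.acyclic d hd).1 y hy
    rw [raisedWeight, weightE7, weightE7, ofMaskPair, insert_ofMask hy'.1 hy'.2,
      mask_ofMask hy'.1]
    rcases h.weight_le d hd y hy with hw | ⟨⟨i, hi, him⟩, hw⟩
    · split_ifs <;> omega
    · rw [if_pos ⟨i, hi, by rw [him]⟩]
      exact hw
  pairwise d hd := (h.acyclic d hd).pairwise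
  notMem' d hd := (h.acyclic' d hd).notMem
  pairwise' d hd := (h.acyclic' d hd).pairwise
  cover d hd σ hσ := by
    rcases h.cover d hd (mask σ) (List.mem_range.2 (mask_lt σ)) (by rw [maskCard_mask, hσ]) with
      hm | hm
    · obtain ⟨y, hy, hyσ⟩ := List.mem_map.1 hm
      refine Or.inl ⟨_, List.mem_map_of_mem hy, ?_⟩
      rw [ofMaskPair, hyσ, ofMask_mask]
    · obtain ⟨y, hy, hyσ⟩ := List.mem_map.1 hm
      have hy' := (h.acyclic' d hd).1 y hy
      refine Or.inr ⟨_, List.mem_map_of_mem hy, ?_⟩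
      rw [ofMaskPair, ← ofMask_mask (insert _ _), insert_ofMask hy'.1 hy'.2, hyσ, ofMask_mask]

/-- A chain of the simplex given by the list of its coefficients. -/
def maskChain (l : List (ℕ × ℤ)) (m : ℕ) : ℤ := (l.lookup m).getD 0

/-- The coefficients of the boundary of a chain. -/
def maskBoundary (l : List (ℕ × ℤ)) (m : ℕ) : ℤ :=
  ∑ s : Fin 8, if m.testBit s then 0 else
    (if maskCard (m % 2 ^ s.val) % 2 = 0 then 1 else -1) * maskChain l (m + 2 ^ s.val)

lemma bd_maskChain (l : List (ℕ × ℤ)) (σ : Finset (Fin 8)) :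
    bd (fun τ => maskChain l (mask τ)) σ = maskBoundary l (mask σ) := by
  rw [bd_apply, maskBoundary]
  refine sum_congr rfl fun s _ => ?_
  have hsign : ∀ (σ : Finset (Fin 8)) (s : Fin 8), (-1 : ℤ) ^ (σ.filter (· < s)).card =
      if maskCard (mask σ % 2 ^ s.val) % 2 = 0 then 1 else -1 := by decide +kernel
  by_cases hs : s ∈ σ
  · rw [if_pos hs, if_pos (testBit_mask.2 hs)]
  · rw [if_neg hs, if_neg (fun h => hs (testBit_mask.1 h)), mask_insert hs, hsign]

/-- The conditions on masks expressing `IsWitness`. -/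
def IsMaskWitness (k : ℕ) {n : ℕ} (td tm : Fin n → ℕ) (β : Fin n → List (ℕ × ℤ)) : Prop :=
  (∀ i, ∀ m ∈ List.range 256, maskBoundary (β i) m ≠ 0 →
    maskCard m = k ∧ maskWeight (td i) m ≤ maskWeight (td i) (tm i)) ∧
  (∀ i, tm i < 256 ∧ (maskBoundary (β i) (tm i)).natAbs = 1) ∧
  ∀ i j, j ≠ i → td j = td i → maskBoundary (β i) (tm j) = 0

instance (k : ℕ) {n : ℕ} (td tm : Fin n → ℕ) (β : Fin n → List (ℕ × ℤ)) :
    Decidable (IsMaskWitness k td tm β) :=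
  inferInstanceAs (Decidable (_ ∧ _ ∧ _))

lemma IsMaskWitness.isWitness {k n : ℕ} {td tm : Fin n → ℕ} {β : Fin n → List (ℕ × ℤ)}
    (h : IsMaskWitness k td tm β) :
    IsWitness weightE7 k td (fun i => ofMask (tm i)) (fun i τ => maskChain (β i) (mask τ)) where
  card_eq i σ hσ := by
    rw [bd_maskChain] at hσ
    rw [← maskCard_mask]
    exact (h.1 i _ (List.mem_range.2 (mask_lt σ)) hσ).1
  weight_le i σ hσ := by
    rw [bd_maskChain] at hσ
    rw [weightE7, weightE7, mask_ofMask (h.2.1 i).1]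
    exact (h.1 i _ (List.mem_range.2 (mask_lt σ)) hσ).2
  isUnit i := by
    rw [bd_maskChain, mask_ofMask (h.2.1 i).1]
    exact Int.isUnit_iff_natAbs_eq.2 (h.2.1 i).2
  eq_zero i j hij hd := by
    rw [bd_maskChain, mask_ofMask (h.2.1 j).1]
    exact h.2.2 i j hij hd

variable {cs}

lemma homology_E7 (h : IsSimplyLaced Mat adjE7) {k n : ℕ} (hk : k < 7) {td tm : Fin n → ℕ}
    (hm : IsMaskMatching k td tm) {β : Fin n → List (ℕ × ℤ)} (hβ : IsMaskWitness k td tm β) :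
    Nonempty (Hgy cs k ≃ₗ[R] ∀ i, CycQuot (td i)) :=
  (hasWeights_E7 cs h).homology_equiv (by rw [Fintype.card_fin]; omega) hm.isMatching hβ.isWitness

lemma subsingleton_homology_E7 (h : IsSimplyLaced Mat adjE7) {k : ℕ} (hk : k < 7)
    (hm : IsMaskMatching k (![] : Fin 0 → ℕ) ![]) : Subsingleton (Hgy cs k) := by
  obtain ⟨e⟩ := homology_E7 (cs := cs) h hk hm (β := ![])
    ⟨fun i => i.elim0, fun i => i.elim0, fun i => i.elim0⟩
  exact e.toEquiv.subsingleton

/-- The `Φ_d` for which `R / (Φ_d)` is a summand of the homology in degree `6`. -/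
def torsionIndices : Fin 10 → ℕ := ![2, 2, 2, 3, 4, 6, 8, 10, 14, 18]

/-- The torsion cells in degree `6`. -/
def torsionMasks : Fin 10 → ℕ := ![63, 189, 252, 95, 250, 126, 187, 125, 126, 126]

/-- The restriction of the fundamental cycle of the boundary of the simplex to the facets opposite
to the given vertices. -/
def facetChain (U : List (Fin 8)) : List (ℕ × ℤ) :=
  U.map fun j => (255 - 2 ^ j.val, (-1) ^ j.val)

/-- Chains whose boundaries are witnesses for the torsion in degree `6`. -/
def torsionChains : Fin 10 → List (ℕ × ℤ) :=
  ![facetChain [0, 1, 6], facetChain [0, 1], facetChain [0], facetChain [3, 5], facetChain [2, 4],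
    facetChain [0], facetChain [2], facetChain [0, 1], facetChain [0], facetChain [0]]

/-- A product over `Fin (n + 1)` splits off its first factor. -/
noncomputable def piFinSuccEquiv {n : ℕ} (d : Fin (n + 1) → ℕ) :
    (∀ i, CycQuot (d i)) ≃ₗ[R] CycQuot (d 0) × ∀ i : Fin n, CycQuot (d i.succ) :=
  { Fin.consEquiv (fun i => CycQuot (d i)) |>.symm with
    map_add' := fun _ _ => rfl
    map_smul' := fun _ _ => rfl }

/-- A product over `Fin 1` is its only factor. -/
noncomputable def piFinOneEquiv (d : Fin 1 → ℕ) : (∀ i, CycQuot (d i)) ≃ₗ[R] CycQuot (d 0) :=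
  LinearEquiv.piUnique R fun i => CycQuot (d i)

/-- The module structure of the homology in degree `6`. -/
noncomputable def torsionEquiv : (∀ i, CycQuot (torsionIndices i)) ≃ₗ[R]
    CycQuot 2 × CycQuot 2 × CycQuot 2 × CycQuot 3 × CycQuot 4 × CycQuot 6 × CycQuot 8 ×
      CycQuot 10 × CycQuot 14 × CycQuot 18 :=
  let r (d : ℕ) := LinearEquiv.refl R (CycQuot d)
  (piFinSuccEquiv ![2, 2, 2, 3, 4, 6, 8, 10, 14, 18]).trans <| (r 2).prodCongr <|
  (piFinSuccEquiv ![2, 2, 3, 4, 6, 8, 10, 14, 18]).trans <| (r 2).prodCongr <|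
  (piFinSuccEquiv ![2, 3, 4, 6, 8, 10, 14, 18]).trans <| (r 2).prodCongr <|
  (piFinSuccEquiv ![3, 4, 6, 8, 10, 14, 18]).trans <| (r 3).prodCongr <|
  (piFinSuccEquiv ![4, 6, 8, 10, 14, 18]).trans <| (r 4).prodCongr <|
  (piFinSuccEquiv ![6, 8, 10, 14, 18]).trans <| (r 6).prodCongr <|
  (piFinSuccEquiv ![8, 10, 14, 18]).trans <| (r 8).prodCongr <|
  (piFinSuccEquiv ![10, 14, 18]).trans <| (r 10).prodCongr <|
  (piFinSuccEquiv ![14, 18]).trans <| (r 14).prodCongr <|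
  piFinOneEquiv ![18]

lemma isSimplyLaced_E7 (hM : ∀ i j : Fin 8, i.val < j.val → Mat.M i j =
      (if (i.val, j.val) ∈ ([(0, 1), (1, 3), (2, 4), (3, 4), (4, 5), (5, 6), (6, 7)] :
        List (ℕ × ℕ)) then 3 else 2)) : IsSimplyLaced Mat adjE7 := by
  have hadj : ∀ i j : Fin 8, i.val < j.val → (adjE7 i j = true ↔
      (i.val, j.val) ∈ ([(0, 1), (1, 3), (2, 4), (3, 4), (4, 5), (5, 6), (6, 7)] :
        List (ℕ × ℕ))) ∧ adjE7 j i = adjE7 i j := by decide +kernel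
  have hlt : ∀ i j : Fin 8, i.val < j.val → Mat i j = if adjE7 i j then 3 else 2 := by
    intro i j hij
    rw [if_congr (hadj i j hij).1 rfl rfl]
    exact hM i j hij
  intro i j hij
  rcases lt_or_gt_of_ne (Fin.val_ne_of_ne hij) with h | h
  · exact hlt i j h
  · rw [Mat.symmetric, hlt j i h, (hadj j i h).2]

end AffineE7

/-- Homology of the weighted complex for the affine Coxeter system of type `Ẽ₇` (generators indexed by `0,…,7`). -/
theorem homology_affine_E7 {W : Type*} [Group W] {Mat : CoxeterMatrix (Fin 8)}
    (cs : CoxeterSystem Mat W)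
    (hM : ∀ i j : Fin 8, i.val < j.val →
      Mat.M i j = (if (i.val, j.val) ∈ ([(0, 1), (1, 3), (2, 4), (3, 4), (4, 5), (5, 6), (6, 7)] : List (ℕ × ℕ)) then 3 else 2)) :
    Nonempty (Hgy cs 0 ≃ₗ[R] (CycQuot 2)) ∧
    Subsingleton (Hgy cs 1) ∧
    Subsingleton (Hgy cs 2) ∧
    Nonempty (Hgy cs 3 ≃ₗ[R] (CycQuot 3)) ∧
    Subsingleton (Hgy cs 4) ∧
    Subsingleton (Hgy cs 5) ∧
    Nonempty (Hgy cs 6 ≃ₗ[R] (CycQuot 2 × CycQuot 2 × CycQuot 2 × CycQuot 3 × CycQuot 4 × CycQuot 6 × CycQuot 8 × CycQuot 10 × CycQuot 14 × CycQuot 18)) ∧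
    Nonempty (Hgy cs 7 ≃ₗ[R] R) ∧
    (∀ k, 8 ≤ k → Subsingleton (Hgy cs k)) := by
  have h := isSimplyLaced_E7 hM
  refine ⟨?_, ?_, ?_, ?_, ?_, ?_, ?_, ?_, ?_⟩
  · obtain ⟨e⟩ := homology_E7 (cs := cs) h (k := 0) (td := ![2]) (tm := ![0])
      (β := ![[(1, 1)]]) (by norm_num) (by decide +kernel) (by decide +kernel)
    exact ⟨e.trans (piFinOneEquiv ![2])⟩
  · exact subsingleton_homology_E7 h (by norm_num) (by decide +kernel)
  · exact subsingleton_homology_E7 h (by norm_num) (by decide +kernel)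
  · obtain ⟨e⟩ := homology_E7 (cs := cs) h (k := 3) (td := ![3]) (tm := ![146])
      (β := ![[(77, 1), (89, 1), (141, -1), (153, -1), (78, -1), (90, -1), (142, 1), (154, 1)]])
      (by norm_num) (by decide +kernel) (by decide +kernel)
    exact ⟨e.trans (piFinOneEquiv ![3])⟩
  · exact subsingleton_homology_E7 h (by norm_num) (by decide +kernel)
  · exact subsingleton_homology_E7 h (by norm_num) (by decide +kernel)
  · obtain ⟨e⟩ := homology_E7 (cs := cs) h (k := 6) (td := torsionIndices) (tm := torsionMasks)
      (β := torsionChains) (by norm_num) (by decide +kernel) (by decide +kernel)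
    exact ⟨e.trans torsionEquiv⟩
  · exact (hasWeights_E7 cs h).homology_top (by rw [Fintype.card_fin])
  · exact fun k hk => (hasWeights_E7 cs h).subsingleton_homology (by rwa [Fintype.card_fin])
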